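/- arXiv:1402.1809 — 9 statements merged into one kernel-verified Lean document; each statement's English description precedes it below -/
import Mathlib

section
/- Let λ > 0. Let v be a positive, twice continuously differentiable function on [b, w_s) with v'(w) < 0 and v''(w) > 0 for all w ∈ [b, w_s), solving the ordinary differential equation λ·v(w)·ln v(w) = − R·v'(w)²/v''(w) + (r w − c)·v'(w) for all w ∈ [b, w_s). Then v is infinitely differentiable on [b, w_s) (i.e. v ∈ C^∞[b, w_s)). -/
/-- Bootstrapping: a positive C² solution of the transformed ODE with
`v' < 0 < v''` on `[b, w_s)` is in fact C^∞ on `[b, w_s)`. -/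
theorem stmt_10 (r μ σ c b ws R lam : ℝ)
    (hr : 0 < r) (hμ : r < μ) (hσ : 0 < σ) (hc : 0 < c)
    (hws : ws = c / r) (hb : b < ws)
    (hR : R = (1 / 2) * ((μ - r) / σ) ^ 2)
    (hlam : 0 < lam)
    (v v' v'' : ℝ → ℝ)
    (hv' : v' = derivWithin v (Set.Ico b ws))
    (hv'' : v'' = derivWithin v' (Set.Ico b ws))
    (hv2 : ContDiffOn ℝ 2 v (Set.Ico b ws))
    (hpos : ∀ w ∈ Set.Ico b ws, 0 < v w)
    (hv'neg : ∀ w ∈ Set.Ico b ws, v' w < 0)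
    (hv''pos : ∀ w ∈ Set.Ico b ws, 0 < v'' w)
    (hode : ∀ w ∈ Set.Ico b ws,
      lam * v w * Real.log (v w) = - R * (v' w) ^ 2 / v'' w + (r * w - c) * v' w) :
    ContDiffOn ℝ (⊤ : ℕ∞) v (Set.Ico b ws) := by
  have hRpos : 0 < R := by
    rw [hR]
    have : 0 < (μ - r) / σ := div_pos (by linarith) hσ
    positivity
  have hu : UniqueDiffOn ℝ (Set.Ico b ws) := uniqueDiffOn_Ico b ws
  have hden : ∀ w ∈ Set.Ico b ws,
      0 < (r * w - c) * v' w - lam * v w * Real.log (v w) := by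
    intro w hw
    have h1 := hode w hw
    have h2 : 0 < R * (v' w) ^ 2 / v'' w :=
      div_pos (mul_pos hRpos (sq_pos_of_neg (hv'neg w hw))) (hv''pos w hw)
    have h3 : - R * (v' w) ^ 2 / v'' w = -(R * (v' w) ^ 2 / v'' w) := by ring
    linarith
  have heq : ∀ w ∈ Set.Ico b ws,
      v'' w = R * (v' w) ^ 2 / ((r * w - c) * v' w - lam * v w * Real.log (v w)) := by
    intro w hw
    have h1 := hode w hw
    have hp := (hv''pos w hw).ne'
    rw [eq_div_iff (hden w hw).ne', h1]
    field_simp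
    ring
  have key : ∀ n : ℕ, ContDiffOn ℝ ((n : WithTop ℕ∞) + 1 + 1) v (Set.Ico b ws) := by
    intro n
    induction n with
    | zero =>
      have : ((0 : ℕ) : WithTop ℕ∞) + 1 + 1 = 2 := by norm_num
      rw [this]; exact hv2
    | succ n ih =>
      have h1 := (contDiffOn_succ_iff_derivWithin hu).1 ih
      have hv1 : ContDiffOn ℝ ((n : WithTop ℕ∞) + 1) v' (Set.Ico b ws) := by
        rw [hv']; exact h1.2.2
      have hv0 : ContDiffOn ℝ ((n : WithTop ℕ∞) + 1) v (Set.Ico b ws) :=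
        ih.of_le le_self_add
      have hlin : ContDiffOn ℝ ((n : WithTop ℕ∞) + 1) (fun w : ℝ => r * w - c) (Set.Ico b ws) :=
        ((contDiff_const.mul contDiff_id).sub contDiff_const).contDiffOn
      have hvv : ContDiffOn ℝ ((n : WithTop ℕ∞) + 1) v'' (Set.Ico b ws) := by
        refine ContDiffOn.congr ?_ heq
        refine (contDiffOn_const.mul (hv1.pow 2)).div ?_ (fun w hw => (hden w hw).ne')
        exact (hlin.mul hv1).sub
          ((contDiffOn_const.mul hv0).mul (hv0.log (fun w hw => (hpos w hw).ne')))
      push_cast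
      have hd : DifferentiableOn ℝ v' (Set.Ico b ws) :=
        ((contDiffOn_succ_iff_derivWithin hu).1 hv1).1
      have hv1' : ContDiffOn ℝ ((n : WithTop ℕ∞) + 1 + 1) v' (Set.Ico b ws) := by
        refine (contDiffOn_succ_iff_derivWithin hu).2 ⟨hd, ?_, ?_⟩
        · intro h; exact absurd h (by exact_mod_cast WithTop.natCast_ne_top (α := ℕ∞) (n + 1))
        · rw [← hv'']; exact hvv
      refine (contDiffOn_succ_iff_derivWithin hu).2 ⟨h1.1, ?_, ?_⟩
      · intro h; exact absurd h (by exact_mod_cast WithTop.natCast_ne_top (α := ℕ∞) (n + 1 + 1))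
      · rw [← hv']; exact hv1'
  refine contDiffOn_infty.2 fun n => (key n).of_le ?_
  rw [add_assoc]; exact le_self_add
end

section
/- Let λ ≥ 0 and ε > 0. Let u be a twice continuously differentiable real-valued function on the open interval (b, w_s) and set v := e^{ε·u}. Then the following are equivalent at every w ∈ (b, w_s): (i) u'(w) < 0, ε·u'(w)² + u''(w) > 0, and λ·u(w) = − R·u'(w)²/(ε·u'(w)² + u''(w)) + (r w − c)·u'(w); (ii) v'(w) < 0, v''(w) > 0, and λ·v(w)·ln v(w) = − R·v'(w)²/v''(w) + (r w − c)·v'(w). -/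
/-- The Cole–Hopf transformation `v = e^{εu}` turns the robust HJB ODE
into the transformed convex ODE, and conversely. -/
theorem stmt_11 (r μ σ c b ws R lam eps : ℝ)
    (hr : 0 < r) (hμ : r < μ) (hσ : 0 < σ) (hc : 0 < c)
    (hws : ws = c / r) (hb : b < ws)
    (hR : R = (1 / 2) * ((μ - r) / σ) ^ 2)
    (hlam : 0 ≤ lam) (heps : 0 < eps)
    (u : ℝ → ℝ) (hu : ContDiffOn ℝ 2 u (Set.Ioo b ws))
    (v : ℝ → ℝ) (hv : ∀ w, v w = Real.exp (eps * u w)) :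
    ∀ w ∈ Set.Ioo b ws,
      ((deriv u w < 0 ∧ 0 < eps * (deriv u w) ^ 2 + deriv (deriv u) w ∧
          lam * u w = - R * (deriv u w) ^ 2 / (eps * (deriv u w) ^ 2 + deriv (deriv u) w)
            + (r * w - c) * deriv u w)
        ↔
       (deriv v w < 0 ∧ 0 < deriv (deriv v) w ∧
          lam * v w * Real.log (v w) = - R * (deriv v w) ^ 2 / deriv (deriv v) w
            + (r * w - c) * deriv v w)) := by
  intro w hw
  have hopen : IsOpen (Set.Ioo b ws) := isOpen_Ioo
  have hd : ∀ x ∈ Set.Ioo b ws, HasDerivAt u (deriv u x) x := fun x hx =>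
    ((hu.differentiableOn (by norm_num)).differentiableAt (hopen.mem_nhds hx)).hasDerivAt
  have hu1 : ContDiffOn ℝ 1 (deriv u) (Set.Ioo b ws) :=
    hu.deriv_of_isOpen hopen (by norm_num)
  have hd2 : HasDerivAt (deriv u) (deriv (deriv u) w) w :=
    ((hu1.differentiableOn (by norm_num)).differentiableAt (hopen.mem_nhds hw)).hasDerivAt
  have hve : v = fun x => Real.exp (eps * u x) := funext hv
  have hdv : ∀ x ∈ Set.Ioo b ws, HasDerivAt v (v x * (eps * deriv u x)) x := by
    intro x hx
    rw [hve]
    exact ((hd x hx).const_mul eps).exp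
  have hv1 : deriv v w = v w * (eps * deriv u w) := (hdv w hw).deriv
  have hev : deriv v =ᶠ[nhds w] fun x => v x * (eps * deriv u x) := by
    filter_upwards [hopen.mem_nhds hw] with x hx
    exact (hdv x hx).deriv
  have hv2 : deriv (deriv v) w
      = eps * v w * (eps * (deriv u w) ^ 2 + deriv (deriv u) w) := by
    rw [hev.deriv_eq]
    have h := ((hdv w hw).mul (hd2.const_mul eps)).deriv
    refine Eq.trans h ?_
    ring
  have hpos : 0 < v w := by rw [hv]; exact Real.exp_pos _
  have hlog : Real.log (v w) = eps * u w := by rw [hv, Real.log_exp]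
  have hk : 0 < eps * v w := mul_pos heps hpos
  rw [hv1, hv2, hlog]
  generalize deriv (deriv u) w = u2
  generalize deriv u w = u1
  have e1 : v w * (eps * u1) = (eps * v w) * u1 := by ring
  rw [e1]
  generalize v w = y at *
  have key : ∀ D : ℝ, 0 < D →
      (lam * u w = - R * u1 ^ 2 / D + (r * w - c) * u1 ↔
        lam * y * (eps * u w) = - R * (eps * y * u1) ^ 2 / (eps * y * D)
          + (r * w - c) * (eps * y * u1)) := by
    intro D hD
    have e2 : - R * (eps * y * u1) ^ 2 / (eps * y * D) + (r * w - c) * (eps * y * u1)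
        = eps * y * (- R * u1 ^ 2 / D + (r * w - c) * u1) := by
      field_simp
    have e3 : lam * y * (eps * u w) = eps * y * (lam * u w) := by ring
    rw [e2, e3]
    exact (mul_right_inj' hk.ne').symm
  constructor
  · rintro ⟨h1, h2, h3⟩
    exact ⟨mul_neg_of_pos_of_neg hk h1, mul_pos hk h2, (key _ h2).1 h3⟩
  · rintro ⟨h1, h2, h3⟩
    have h2' := (mul_pos_iff_of_pos_left hk).1 h2
    exact ⟨(pos_iff_neg_of_mul_neg h1).1 hk, h2', (key _ h2').2 h3⟩
end

section
/- Let λ > 0 and ε ≥ 0. Let ψ be continuously differentiable on [b, w_s] and twice continuously differentiable on [b, w_s), with ψ(w) > 0, ψ'(w) < 0 and ε·ψ'(w)² + ψ''(w) > 0 for all w ∈ [b, w_s), solving λ·ψ(w) = − R·ψ'(w)²/(ε·ψ'(w)² + ψ''(w)) + (r w − c)·ψ'(w) for all w ∈ [b, w_s). Define π*(w) := −((μ − r)/σ²)·ψ'(w)/(ε·ψ'(w)² + ψ''(w)). Then 0 < π*(w) < 2(c − r w)/(μ − r) for all w ∈ [b, w_s). -/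
/-- Bounds on the optimal investment feedback π*. -/
theorem stmt_12 (r μ σ c b ws R lam eps : ℝ)
    (hr : 0 < r) (hμ : r < μ) (hσ : 0 < σ) (hc : 0 < c)
    (hws : ws = c / r) (hb : b < ws)
    (hR : R = (1 / 2) * ((μ - r) / σ) ^ 2)
    (hlam : 0 < lam) (heps : 0 ≤ eps)
    (ψ ψ' ψ'' : ℝ → ℝ)
    (hψ' : ψ' = derivWithin ψ (Set.Icc b ws))
    (hψ'' : ψ'' = derivWithin ψ' (Set.Icc b ws))
    (hψ1 : ContDiffOn ℝ 1 ψ (Set.Icc b ws))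
    (hψ2 : ContDiffOn ℝ 2 ψ (Set.Ico b ws))
    (hpos : ∀ w ∈ Set.Ico b ws, 0 < ψ w)
    (hψ'neg : ∀ w ∈ Set.Ico b ws, ψ' w < 0)
    (hdenom : ∀ w ∈ Set.Ico b ws, 0 < eps * (ψ' w) ^ 2 + ψ'' w)
    (hode : ∀ w ∈ Set.Ico b ws,
      lam * ψ w = - R * (ψ' w) ^ 2 / (eps * (ψ' w) ^ 2 + ψ'' w) + (r * w - c) * ψ' w)
    (πs : ℝ → ℝ)
    (hπs : ∀ w, πs w = -((μ - r) / σ ^ 2) * ψ' w / (eps * (ψ' w) ^ 2 + ψ'' w)) :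
    ∀ w ∈ Set.Ico b ws, 0 < πs w ∧ πs w < 2 * (c - r * w) / (μ - r) := by
  intro w hw
  have hp := hψ'neg w hw
  have hD := hdenom w hw
  have ho := hode w hw
  have hl := mul_pos hlam (hpos w hw)
  rw [hπs w]
  generalize eps * (ψ' w) ^ 2 + ψ'' w = D at *
  generalize ψ' w = p at *
  have hm : 0 < μ - r := sub_pos.2 hμ
  constructor
  · apply div_pos _ hD
    have h1 : 0 < (μ - r) / σ ^ 2 := by positivity
    nlinarith
  · rw [lt_div_iff₀ hm]
    have h2 : -((μ - r) / σ ^ 2) * p / D * (μ - r) = 2 * (-(R * p / D)) := by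
      rw [hR]; field_simp
    have h3 : -R * p ^ 2 / D = -(R * p / D) * p := by ring
    rw [h2]
    rw [ho, h3] at hl
    nlinarith
end

section
/- Let λ > 0 and ε > 0. Let ψ be continuously differentiable on [b, w_s] and twice continuously differentiable on [b, w_s), with ψ(w) > 0, ψ'(w) < 0 and ε·ψ'(w)² + ψ''(w) > 0 for all w ∈ [b, w_s), solving λ·ψ(w) = − R·ψ'(w)²/(ε·ψ'(w)² + ψ''(w)) + (r w − c)·ψ'(w) for all w ∈ [b, w_s). Define π*(w) := −((μ − r)/σ²)·ψ'(w)/(ε·ψ'(w)² + ψ''(w)) and θ*(w) := σ·ε·π*(w)·ψ'(w). Then: (i) (2σε/(μ − r))·(c − r w)·ψ'(w) < θ*(w) < 0 for all w ∈ [b, w_s); (ii) θ* is bounded on [b, w_s); and (iii) lim_{w → w_s−} θ*(w) = 0. -/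
/-- Bounds, boundedness and the limit at the safe level of the optimal
drift-distortion feedback θ*. -/
theorem stmt_13 (r μ σ c b ws R lam eps : ℝ)
    (hr : 0 < r) (hμ : r < μ) (hσ : 0 < σ) (hc : 0 < c)
    (hws : ws = c / r) (hb : b < ws)
    (hR : R = (1 / 2) * ((μ - r) / σ) ^ 2)
    (hlam : 0 < lam) (heps : 0 < eps)
    (ψ ψ' ψ'' : ℝ → ℝ)
    (hψ' : ψ' = derivWithin ψ (Set.Icc b ws))
    (hψ'' : ψ'' = derivWithin ψ' (Set.Icc b ws))
    (hψ1 : ContDiffOn ℝ 1 ψ (Set.Icc b ws))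
    (hψ2 : ContDiffOn ℝ 2 ψ (Set.Ico b ws))
    (hpos : ∀ w ∈ Set.Ico b ws, 0 < ψ w)
    (hψ'neg : ∀ w ∈ Set.Ico b ws, ψ' w < 0)
    (hdenom : ∀ w ∈ Set.Ico b ws, 0 < eps * (ψ' w) ^ 2 + ψ'' w)
    (hode : ∀ w ∈ Set.Ico b ws,
      lam * ψ w = - R * (ψ' w) ^ 2 / (eps * (ψ' w) ^ 2 + ψ'' w) + (r * w - c) * ψ' w)
    (πs θs : ℝ → ℝ)
    (hπs : ∀ w, πs w = -((μ - r) / σ ^ 2) * ψ' w / (eps * (ψ' w) ^ 2 + ψ'' w))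
    (hθs : ∀ w, θs w = σ * eps * πs w * ψ' w) :
    (∀ w ∈ Set.Ico b ws,
      (2 * σ * eps / (μ - r)) * (c - r * w) * ψ' w < θs w ∧ θs w < 0) ∧
    (∃ M, ∀ w ∈ Set.Ico b ws, |θs w| ≤ M) ∧
    Filter.Tendsto θs (nhdsWithin ws (Set.Ico b ws)) (nhds 0) := by
  have hm : 0 < μ - r := sub_pos.mpr hμ
  have hk : 0 < 2 * σ * eps / (μ - r) := by positivity
  have hRpos : 0 < R := by rw [hR]; positivity
  have key : ∀ w ∈ Set.Ico b ws,
      (2 * σ * eps / (μ - r)) * (c - r * w) * ψ' w < θs w ∧ θs w < 0 := by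
    intro w hw
    have hD := hdenom w hw
    have hn := hψ'neg w hw
    have hp := hpos w hw
    have ho := hode w hw
    have hQ : 0 < (ψ' w) ^ 2 / (eps * (ψ' w) ^ 2 + ψ'' w) := by
      have : 0 < (ψ' w) ^ 2 := by nlinarith
      positivity
    have hθ : θs w = -((2 * σ * eps / (μ - r)) * (R * ((ψ' w) ^ 2 / (eps * (ψ' w) ^ 2 + ψ'' w)))) := by
      rw [hθs, hπs, hR]
      generalize eps * (ψ' w) ^ 2 + ψ'' w = D at hD
      field_simp
    rw [mul_div_assoc] at ho
    generalize (ψ' w) ^ 2 / (eps * (ψ' w) ^ 2 + ψ'' w) = Q at *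
    rw [hθ]
    constructor
    · have h1 : (c - r * w) * ψ' w < -(R * Q) := by
        have := mul_pos hlam hp
        nlinarith
      have := mul_lt_mul_of_pos_left h1 hk
      linarith
    · have : 0 < (2 * σ * eps / (μ - r)) * (R * Q) := by positivity
      linarith
  have hcont : ContinuousOn ψ' (Set.Icc b ws) := by
    rw [hψ']
    exact hψ1.continuousOn_derivWithin (uniqueDiffOn_Icc hb) le_rfl
  have hgc : ContinuousOn (fun w => (2 * σ * eps / (μ - r)) * (c - r * w) * ψ' w)
      (Set.Icc b ws) := by
    refine ContinuousOn.mul ?_ hcont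
    fun_prop
  refine ⟨key, ?_, ?_⟩
  · obtain ⟨M, hM⟩ := isCompact_Icc.exists_bound_of_continuousOn hgc
    refine ⟨M, fun w hw => ?_⟩
    have h1 := hM w (Set.Ico_subset_Icc_self hw)
    have h2 := key w hw
    rw [Real.norm_eq_abs] at h1
    have h3 := (abs_le.mp h1).1
    rw [abs_of_neg h2.2]
    linarith [h2.1]
  · have h0 := (hgc ws (Set.right_mem_Icc.mpr hb.le)).mono_left
      (nhdsWithin_mono ws (Set.Ico_subset_Icc_self))
    have hz : c - r * ws = 0 := by rw [hws]; field_simp; ring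
    simp only [hz, mul_zero, zero_mul] at h0
    refine tendsto_of_tendsto_of_tendsto_of_le_of_le' h0 tendsto_const_nhds ?_ ?_
    · filter_upwards [self_mem_nhdsWithin] with w hw using (key w hw).1.le
    · filter_upwards [self_mem_nhdsWithin] with w hw using (key w hw).2.le
end

section
/- Let λ > 0 and 0 ≤ ε₁ < ε₂. For i = 1, 2, let ψᵢ be continuously differentiable on [b, w_s] and three times continuously differentiable on [b, w_s), with ψᵢ(b) = 1, ψᵢ(w_s) = 0, 0 ≤ ψᵢ ≤ 1 on [b, w_s], ψᵢ'(w) < 0 and εᵢ·ψᵢ'(w)² + ψᵢ''(w) > 0 for all w ∈ [b, w_s), solving λ·ψᵢ(w) = − R·ψᵢ'(w)²/(εᵢ·ψᵢ'(w)² + ψᵢ''(w)) + (r w − c)·ψᵢ'(w) for all w ∈ [b, w_s). Assume ψ₁(w) ≤ ψ₂(w) for all w ∈ [b, w_s]. Define πᵢ(w) := −((μ − r)/σ²)·ψᵢ'(w)/(εᵢ·ψᵢ'(w)² + ψᵢ''(w)). Then π₁(w) ≥ π₂(w) for all w ∈ [b, w_s). In particular, if ψ₀(w) := ((c − r w)/(c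 − r b))^d ≤ ψ₂(w) on [b, w_s], then π₂(w) ≤ π₀(w) := ((μ − r)/σ²)·(c − r w)/((d − 1)·r) for all w ∈ [b, w_s). -/
/-- A function with growing positive part that is dominated by a quantity vanishing at `ws`
is nonpositive. -/
lemma aux_nonpos (b ws K : ℝ) (δ δ' : ℝ → ℝ) 
    (hder : ∀ w ∈ Set.Ico b ws, HasDerivWithinAt δ (δ' w) (Set.Icc b ws) w)
    (hpos : ∀ w ∈ Set.Ico b ws, 0 < δ w → 0 < δ' w)
    (hbd : ∀ w ∈ Set.Ico b ws, δ w ≤ K * (ws - w)) (hK : 0 < K) :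
    ∀ w ∈ Set.Ico b ws, δ w ≤ 0 := by
  intro w₀ hw₀
  by_contra! h0
  obtain ⟨w₁, h01, h1s, hw₁⟩ : ∃ w₁, w₀ < w₁ ∧ w₁ < ws ∧ δ w₁ < δ w₀ := by
    have hlt := hw₀.2
    set t := min ((ws - w₀) / 2) (δ w₀ / (2 * K)) with ht
    have ht0 : 0 < t := lt_min (by linarith) (by positivity)
    have ht1 : t ≤ (ws - w₀) / 2 := min_le_left _ _
    have ht2 : t ≤ δ w₀ / (2 * K) := min_le_right _ _
    refine ⟨ws - t, by linarith, by linarith, ?_⟩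
    have h1 := hbd (ws - t) ⟨by linarith [hw₀.1], by linarith⟩
    have h2 : K * t ≤ δ w₀ / 2 := by
      calc K * t ≤ K * (δ w₀ / (2 * K)) := by gcongr
        _ = δ w₀ / 2 := by field_simp
    have h3 : K * (ws - (ws - t)) = K * t := by ring
    linarith
  have hcont : ContinuousOn δ (Set.Icc w₀ w₁) := by
    intro x hx
    exact ((hder x ⟨hw₀.1.trans hx.1, hx.2.trans_lt h1s⟩).continuousWithinAt).mono
      (Set.Icc_subset_Icc hw₀.1 h1s.le)
  obtain ⟨m, hm, hmax⟩ := isCompact_Icc.exists_isMaxOn (Set.nonempty_Icc.2 h01.le) hcont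
  have hm0 : δ w₀ ≤ δ m := hmax (Set.left_mem_Icc.2 h01.le)
  have hm1 : m < w₁ := by
    rcases hm.2.lt_or_eq with h | h
    · exact h
    · subst h; linarith
  have hmI : m ∈ Set.Ico b ws := ⟨hw₀.1.trans hm.1, hm1.trans h1s⟩
  have hd := ((hder m hmI).mono (Set.Icc_subset_Icc hmI.1 h1s.le))
  have hp := hpos m hmI (by linarith)
  have hloc : IsLocalMaxOn δ (Set.Icc m w₁) m :=
    (hmax.on_subset (Set.Icc_subset_Icc_left hm.1)).localize
  have hd' := hasDerivWithinAt_iff_hasFDerivWithinAt.1 hd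
  have := hloc.hasFDerivWithinAt_nonpos hd' (y := w₁ - m)
    (sub_mem_posTangentConeAt_of_segment_subset (by rw [segment_eq_Icc hm1.le]))
  simp at this
  nlinarith

/-- Basic facts about the ratio `ψ / (-ψ')` for a solution of the ODE. -/
lemma aux_sol (r c b ws R lam ε : ℝ) (hR : 0 < R)
    (ψ ψ' ψ'' : ℝ → ℝ)
    (hψ' : ψ' = derivWithin ψ (Set.Icc b ws))
    (hψ'' : ψ'' = derivWithin ψ' (Set.Icc b ws))
    (h3 : ContDiffOn ℝ 3 ψ (Set.Ico b ws))
    (hneg : ∀ w ∈ Set.Ico b ws, ψ' w < 0)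
    (hden : ∀ w ∈ Set.Ico b ws, 0 < ε * (ψ' w) ^ 2 + ψ'' w)
    (hode : ∀ w ∈ Set.Ico b ws,
      lam * ψ w = - R * (ψ' w) ^ 2 / (ε * (ψ' w) ^ 2 + ψ'' w) + (r * w - c) * ψ' w) :
    ∀ w ∈ Set.Ico b ws,
      HasDerivWithinAt (fun x => ψ x / (-ψ' x))
        (-1 + R * (ψ w / (-ψ' w)) / (c - r * w - lam * (ψ w / (-ψ' w))) - ε * ψ w)
        (Set.Icc b ws) w ∧
      lam * (ψ w / (-ψ' w)) < c - r * w ∧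
      (-ψ' w) / (ε * (ψ' w) ^ 2 + ψ'' w) = (c - r * w - lam * (ψ w / (-ψ' w))) / R := by
  intro w hw
  have hset : ∀ x ∈ Set.Ico b ws, (Set.Icc b ws) =ᶠ[nhds x] (Set.Ico b ws) := by
    intro x hx
    filter_upwards [Iio_mem_nhds hx.2] with y hy
    apply propext
    exact ⟨fun h => ⟨h.1, hy⟩, fun h => ⟨h.1, h.2.le⟩⟩
  have hud : UniqueDiffOn ℝ (Set.Ico b ws) := uniqueDiffOn_Ico b ws
  have hd1 : HasDerivWithinAt ψ (ψ' w) (Set.Icc b ws) w := by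
    have h : DifferentiableWithinAt ℝ ψ (Set.Ico b ws) w :=
      (h3.differentiableOn (by norm_num)) w hw
    rw [hψ']
    exact ((differentiableWithinAt_congr_set (hset w hw)).2 h).hasDerivWithinAt
  have hd2 : HasDerivWithinAt ψ' (ψ'' w) (Set.Icc b ws) w := by
    have h : ContDiffOn ℝ 2 (derivWithin ψ (Set.Ico b ws)) (Set.Ico b ws) :=
      h3.derivWithin hud (by norm_num)
    have h' : DifferentiableWithinAt ℝ (derivWithin ψ (Set.Ico b ws)) (Set.Ico b ws) w :=
      (h.differentiableOn (by norm_num)) w hw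
    have heq : ∀ x ∈ Set.Ico b ws, ψ' x = derivWithin ψ (Set.Ico b ws) x := by
      intro x hx
      rw [hψ']
      exact derivWithin_congr_set (hset x hx)
    have h2 : DifferentiableWithinAt ℝ ψ' (Set.Ico b ws) w := h'.congr heq (heq w hw)
    rw [hψ'']
    exact ((differentiableWithinAt_congr_set (hset w hw)).2 h2).hasDerivWithinAt
  have hn := hneg w hw
  have hD := hden w hw
  have ho := hode w hw
  have hdq := hd1.div hd2.neg (by simpa using hn.ne)
  simp only [Pi.neg_apply] at hdq
  obtain ⟨p, hp⟩ : ∃ p, p = -ψ' w := ⟨_, rfl⟩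
  have hp' : ψ' w = -p := by linarith
  obtain ⟨D, hDD⟩ : ∃ D, D = ε * (ψ' w) ^ 2 + ψ'' w := ⟨_, rfl⟩
  have hψ2 : ψ'' w = D - ε * p ^ 2 := by rw [hDD, hp']; ring
  rw [← hDD] at ho hD ⊢
  rw [hψ2] at hdq
  rw [hp'] at ho hdq hn ⊢
  simp only [neg_neg] at *
  have hp0 : 0 < p := by linarith
  have key : c - r * w - lam * (ψ w / p) = R * p / D := by
    have : lam * (ψ w / p) = (lam * ψ w) / p := by ring
    rw [this, ho]
    field_simp
    ring
  have hpos : 0 < R * p / D := by positivity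
  refine ⟨?_, by linarith, ?_⟩
  · rw [key]
    refine HasDerivWithinAt.congr_deriv (f' := _) hdq ?_
    field_simp
    ring
  · rw [key]; field_simp

/-- Comparison of the two right-hand sides. -/
lemma aux_mono (R lam y q₁ q₂ : ℝ) (hR : 0 < R) (hlam : 0 < lam)
    (h1 : lam * q₁ < y) (h2 : lam * q₂ < y) (hq2 : 0 ≤ q₂) (hlt : q₂ < q₁) :
    R * q₂ / (y - lam * q₂) < R * q₁ / (y - lam * q₁) := by
  have hy : 0 < y := by nlinarith
  rw [div_lt_div_iff₀ (by linarith) (by linarith)]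
  have : 0 < R * y * (q₁ - q₂) := by have := sub_pos.2 hlt; positivity
  nlinarith

/-- Monotonicity of the optimal investment feedback in the
ambiguity-aversion parameter ε. -/
theorem stmt_14 (r μ σ c b ws R lam d eps₁ eps₂ : ℝ)
    (hr : 0 < r) (hμ : r < μ) (hσ : 0 < σ) (hc : 0 < c)
    (hws : ws = c / r) (hb : b < ws)
    (hR : R = (1 / 2) * ((μ - r) / σ) ^ 2)
    (hlam : 0 < lam)
    (hd : d = (1 / (2 * r)) *
      ((r + lam + R) + Real.sqrt ((r + lam + R) ^ 2 - 4 * r * lam)))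
    (heps₁ : 0 ≤ eps₁) (heps₁₂ : eps₁ < eps₂)
    (ψ₁ ψ₁' ψ₁'' ψ₂ ψ₂' ψ₂'' : ℝ → ℝ)
    (hψ₁' : ψ₁' = derivWithin ψ₁ (Set.Icc b ws))
    (hψ₁'' : ψ₁'' = derivWithin ψ₁' (Set.Icc b ws))
    (hψ₂' : ψ₂' = derivWithin ψ₂ (Set.Icc b ws))
    (hψ₂'' : ψ₂'' = derivWithin ψ₂' (Set.Icc b ws))
    (hψ₁_c1 : ContDiffOn ℝ 1 ψ₁ (Set.Icc b ws))
    (hψ₁_c3 : ContDiffOn ℝ 3 ψ₁ (Set.Ico b ws))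
    (hψ₂_c1 : ContDiffOn ℝ 1 ψ₂ (Set.Icc b ws))
    (hψ₂_c3 : ContDiffOn ℝ 3 ψ₂ (Set.Ico b ws))
    (hψ₁b : ψ₁ b = 1) (hψ₁ws : ψ₁ ws = 0)
    (hψ₂b : ψ₂ b = 1) (hψ₂ws : ψ₂ ws = 0)
    (hψ₁rng : ∀ w ∈ Set.Icc b ws, ψ₁ w ∈ Set.Icc (0 : ℝ) 1)
    (hψ₂rng : ∀ w ∈ Set.Icc b ws, ψ₂ w ∈ Set.Icc (0 : ℝ) 1)
    (hψ₁'neg : ∀ w ∈ Set.Ico b ws, ψ₁' w < 0)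
    (hψ₂'neg : ∀ w ∈ Set.Ico b ws, ψ₂' w < 0)
    (hden₁ : ∀ w ∈ Set.Ico b ws, 0 < eps₁ * (ψ₁' w) ^ 2 + ψ₁'' w)
    (hden₂ : ∀ w ∈ Set.Ico b ws, 0 < eps₂ * (ψ₂' w) ^ 2 + ψ₂'' w)
    (hode₁ : ∀ w ∈ Set.Ico b ws,
      lam * ψ₁ w = - R * (ψ₁' w) ^ 2 / (eps₁ * (ψ₁' w) ^ 2 + ψ₁'' w)
        + (r * w - c) * ψ₁' w)
    (hode₂ : ∀ w ∈ Set.Ico b ws,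
      lam * ψ₂ w = - R * (ψ₂' w) ^ 2 / (eps₂ * (ψ₂' w) ^ 2 + ψ₂'' w)
        + (r * w - c) * ψ₂' w)
    (hcomp : ∀ w ∈ Set.Icc b ws, ψ₁ w ≤ ψ₂ w)
    (π₁ π₂ : ℝ → ℝ)
    (hπ₁ : ∀ w, π₁ w = -((μ - r) / σ ^ 2) * ψ₁' w / (eps₁ * (ψ₁' w) ^ 2 + ψ₁'' w))
    (hπ₂ : ∀ w, π₂ w = -((μ - r) / σ ^ 2) * ψ₂' w / (eps₂ * (ψ₂' w) ^ 2 + ψ₂'' w)) :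
    (∀ w ∈ Set.Ico b ws, π₂ w ≤ π₁ w) ∧
    ((∀ w ∈ Set.Icc b ws, ((c - r * w) / (c - r * b)) ^ d ≤ ψ₂ w) →
      ∀ w ∈ Set.Ico b ws, π₂ w ≤ ((μ - r) / σ ^ 2) * (c - r * w) / ((d - 1) * r)) := by
  have hk : 0 < (μ - r) / σ ^ 2 := div_pos (by linarith) (by positivity)
  have hR0 : 0 < R := by
    have : 0 < (μ - r) / σ := div_pos (by linarith) hσ
    rw [hR]; positivity
  have hcw : ∀ w, c - r * w = r * (ws - w) := by intro w; rw [hws]; field_simp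
  have s1 := aux_sol r c b ws R lam eps₁ hR0 ψ₁ ψ₁' ψ₁'' hψ₁' hψ₁'' hψ₁_c3 hψ₁'neg hden₁ hode₁
  have s2 := aux_sol r c b ws R lam eps₂ hR0 ψ₂ ψ₂' ψ₂'' hψ₂' hψ₂'' hψ₂_c3 hψ₂'neg hden₂ hode₂
  have q2n : ∀ w ∈ Set.Ico b ws, 0 ≤ ψ₂ w / (-ψ₂' w) := fun w hw =>
    div_nonneg (hψ₂rng w ⟨hw.1, hw.2.le⟩).1 (by linarith [hψ₂'neg w hw])
  have e2 : ∀ w ∈ Set.Ico b ws,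
      π₂ w = (μ - r) / σ ^ 2 * ((c - r * w - lam * (ψ₂ w / (-ψ₂' w))) / R) := by
    intro w hw
    rw [hπ₂, ← (s2 w hw).2.2]; ring
  refine ⟨?_, ?_⟩
  · have main := aux_nonpos b ws (r / lam) _ _
      (fun w hw => (s1 w hw).1.sub (s2 w hw).1)
      (by
        intro w hw hpos
        simp only [Pi.sub_apply] at hpos
        have hm := aux_mono R lam (c - r * w) _ _ hR0 hlam (s1 w hw).2.1 (s2 w hw).2.1
          (q2n w hw) (sub_pos.1 hpos)
        have hww : w ∈ Set.Icc b ws := ⟨hw.1, hw.2.le⟩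
        have : eps₁ * ψ₁ w ≤ eps₂ * ψ₂ w :=
          mul_le_mul heps₁₂.le (hcomp w hww) (hψ₁rng w hww).1 (by linarith)
        linarith)
      (by
        intro w hw
        simp only [Pi.sub_apply]
        have h1 := (s1 w hw).2.1
        have h2 := q2n w hw
        rw [hcw] at h1
        have : ψ₁ w / (-ψ₁' w) < r / lam * (ws - w) := by
          rw [div_mul_eq_mul_div, lt_div_iff₀ hlam]; linarith
        linarith)
      (by positivity)
    intro w hw
    have hm := main w hw
    simp only [Pi.sub_apply] at hm
    have e1 : π₁ w = (μ - r) / σ ^ 2 * ((c - r * w - lam * (ψ₁ w / (-ψ₁' w))) / R) := by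
      rw [hπ₁, ← (s1 w hw).2.2]; ring
    rw [e1, e2 w hw]
    have : ψ₁ w / (-ψ₁' w) ≤ ψ₂ w / (-ψ₂' w) := by linarith
    gcongr
  · intro _
    have hdisc : 0 ≤ (r + lam + R) ^ 2 - 4 * r * lam := by nlinarith [sq_nonneg (r - lam)]
    have hquad : r * d ^ 2 - (r + lam + R) * d + lam = 0 := by
      have hs := Real.sq_sqrt hdisc
      generalize Real.sqrt ((r + lam + R) ^ 2 - 4 * r * lam) = S at hd hs
      rw [hd]
      field_simp
      nlinarith
    have hd1 : 1 < d := by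
      have hs : |r - lam - R| < Real.sqrt ((r + lam + R) ^ 2 - 4 * r * lam) := by
        apply Real.lt_sqrt_of_sq_lt
        rw [sq_abs]
        nlinarith [mul_pos hr hR0]
      have := (abs_lt.1 hs).2
      rw [hd, one_div, inv_mul_eq_div, lt_div_iff₀ (by positivity)]
      linarith
    have hd0 : 0 < d := by linarith
    have hrel : (d * r - lam) * (d - 1) = d * R := by nlinarith
    have hdr : 0 < d * r - lam := by
      have : 0 < (d * r - lam) * (d - 1) := by rw [hrel]; positivity
      exact pos_of_mul_pos_left this (by linarith)
    have hq0 : ∀ w ∈ Set.Ico b ws, lam * ((c - r * w) / (d * r)) < c - r * w := by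
      intro w hw
      have hy : 0 < c - r * w := by rw [hcw]; exact mul_pos hr (by linarith [hw.2])
      rw [mul_div_assoc', div_lt_iff₀ (by positivity)]
      nlinarith
    have hval : ∀ w ∈ Set.Ico b ws, (c - r * w - lam * ((c - r * w) / (d * r))) =
        R * ((c - r * w) / ((d - 1) * r)) := by
      intro w hw
      have : d - 1 ≠ 0 := by linarith
      field_simp
      linear_combination (c - r * w) * hrel
    have hder : ∀ w ∈ Set.Ico b ws, HasDerivWithinAt (fun x => (c - r * x) / (d * r))
        (-1 / d) (Set.Icc b ws) w := by
      intro w hw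
      have h := ((((hasDerivAt_id w).const_mul r).const_sub c).div_const (d * r)).hasDerivWithinAt
        (s := Set.Icc b ws)
      simp only [id] at h
      refine h.congr_deriv ?_
      field_simp
    have main := aux_nonpos b ws (r / lam) _ _
      (fun w hw => (hder w hw).sub (s2 w hw).1)
      (by
        intro w hw hpos
        simp only [Pi.sub_apply] at hpos
        have hm := aux_mono R lam (c - r * w) _ _ hR0 hlam (hq0 w hw) (s2 w hw).2.1
          (q2n w hw) (sub_pos.1 hpos)
        have hww : w ∈ Set.Icc b ws := ⟨hw.1, hw.2.le⟩
        have h3 : 0 ≤ eps₂ * ψ₂ w := mul_nonneg (by linarith) (hψ₂rng w hww).1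
        have hy : 0 < c - r * w := by rw [hcw]; exact mul_pos hr (by linarith [hw.2])
        have h4 : R * ((c - r * w) / (d * r)) / (c - r * w - lam * ((c - r * w) / (d * r)))
            = 1 + -1 / d := by
          rw [hval w hw]
          have : d - 1 ≠ 0 := by linarith
          field_simp
          ring
        linarith)
      (by
        intro w hw
        simp only [Pi.sub_apply]
        have h1 := hq0 w hw
        have h2 := q2n w hw
        have : (c - r * w) / (d * r) < r / lam * (ws - w) := by
          rw [div_mul_eq_mul_div, lt_div_iff₀ hlam, ← hcw]; linarith
        linarith)
      (by positivity)
    intro w hw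
    have hm := main w hw
    simp only [Pi.sub_apply] at hm
    have h5 : (c - r * w) / (d * r) ≤ ψ₂ w / (-ψ₂' w) := by linarith
    have h6 : (c - r * w) / ((d - 1) * r) = (c - r * w - lam * ((c - r * w) / (d * r))) / R := by
      rw [hval w hw]; field_simp
    rw [e2 w hw, mul_div_assoc, h6]
    gcongr
end

section
/- Let λ > 0, ε ≥ 0, and suppose r ≤ λ. Let ψ be continuously differentiable on [b, w_s] and twice continuously differentiable on [b, w_s), with ψ(b) = 1, ψ(w_s) = 0, ψ'(w) < 0 and ε·ψ'(w)² + ψ''(w) > 0 for all w ∈ [b, w_s), solving λ·ψ(w) = − R·ψ'(w)²/(ε·ψ'(w)² + ψ''(w)) + (r w − c)·ψ'(w) for all w ∈ [b, w_s). Then ψ is convex on [b, w_s]; and if moreover r < λ, then ψ is strictly convex on [b, w_s]. -/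
/-- When r ≤ λ, the robust value function is convex (strictly convex if
r < λ). -/
theorem stmt_16 (r μ σ c b ws R lam eps : ℝ)
    (hr : 0 < r) (hμ : r < μ) (hσ : 0 < σ) (hc : 0 < c)
    (hws : ws = c / r) (hb : b < ws)
    (hR : R = (1 / 2) * ((μ - r) / σ) ^ 2)
    (hlam : 0 < lam) (heps : 0 ≤ eps)
    (hrlam : r ≤ lam)
    (ψ ψ' ψ'' : ℝ → ℝ)
    (hψ' : ψ' = derivWithin ψ (Set.Icc b ws))
    (hψ'' : ψ'' = derivWithin ψ' (Set.Icc b ws))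
    (hψ1 : ContDiffOn ℝ 1 ψ (Set.Icc b ws))
    (hψ2 : ContDiffOn ℝ 2 ψ (Set.Ico b ws))
    (hψb : ψ b = 1) (hψws : ψ ws = 0)
    (hψ'neg : ∀ w ∈ Set.Ico b ws, ψ' w < 0)
    (hdenom : ∀ w ∈ Set.Ico b ws, 0 < eps * (ψ' w) ^ 2 + ψ'' w)
    (hode : ∀ w ∈ Set.Ico b ws,
      lam * ψ w = - R * (ψ' w) ^ 2 / (eps * (ψ' w) ^ 2 + ψ'' w) + (r * w - c) * ψ' w) :
    ConvexOn ℝ (Set.Icc b ws) ψ ∧ (r < lam → StrictConvexOn ℝ (Set.Icc b ws) ψ) := by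
  have hRpos : 0 < R := by
    have : 0 < (μ - r) / σ := div_pos (by linarith) hσ
    rw [hR]; positivity
  have hcr : c = r * ws := by rw [hws]; field_simp
  have hud : UniqueDiffOn ℝ (Set.Icc b ws) := uniqueDiffOn_Icc hb
  have hud2 : UniqueDiffOn ℝ (Set.Ico b ws) := uniqueDiffOn_Ico b ws
  have hnhds : ∀ w ∈ Set.Ico b ws, Set.Ico b ws ∈ nhdsWithin w (Set.Icc b ws) := by
    intro w hw
    filter_upwards [self_mem_nhdsWithin,
      mem_nhdsWithin_of_mem_nhds (Iio_mem_nhds hw.2)] with x hx hx2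
    exact ⟨hx.1, hx2⟩
  -- first derivative
  have hd1 : ∀ w ∈ Set.Icc b ws, HasDerivWithinAt ψ (ψ' w) (Set.Icc b ws) w := by
    intro w hw
    rw [hψ']
    exact ((hψ1.differentiableOn (by norm_num)) w hw).hasDerivWithinAt
  have hcont' : ContinuousOn ψ' (Set.Icc b ws) := by
    rw [hψ']
    exact hψ1.continuousOn_derivWithin hud (by norm_num)
  have heq : ∀ w ∈ Set.Ico b ws, ψ' w = derivWithin ψ (Set.Ico b ws) w := by
    intro w hw
    exact (((hd1 w (Set.Ico_subset_Icc_self hw)).mono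
      Set.Ico_subset_Icc_self).derivWithin (hud2 w hw)).symm
  have hd2 : ∀ w ∈ Set.Ico b ws, HasDerivWithinAt ψ' (ψ'' w) (Set.Icc b ws) w := by
    intro w hw
    rw [hψ'']
    have h1 : DifferentiableOn ℝ (derivWithin ψ (Set.Ico b ws)) (Set.Ico b ws) :=
      (hψ2.derivWithin (m := 1) hud2 (by norm_num)).differentiableOn (by norm_num)
    have h2 : DifferentiableWithinAt ℝ ψ' (Set.Ico b ws) w :=
      (h1 w hw).congr heq (heq w hw)
    exact (h2.mono_of_mem_nhdsWithin (hnhds w hw)).hasDerivWithinAt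
  -- the auxiliary function
  set g : ℝ → ℝ := fun w => (r * w - c) * ψ' w - lam * ψ w with hg
  have hgc : ContinuousOn g (Set.Icc b ws) :=
    ((by fun_prop : ContinuousOn (fun w => r * w - c) (Set.Icc b ws)).mul hcont').sub
      (continuousOn_const.mul hψ1.continuousOn)
  have hgws : g ws = 0 := by simp [hg, hψws, hcr]
  have hgeq : ∀ w ∈ Set.Ico b ws, g w * (eps * (ψ' w) ^ 2 + ψ'' w) = R * (ψ' w) ^ 2 := by
    intro w hw
    have h := hode w hw
    have hd := hdenom w hw
    have : g w = R * (ψ' w) ^ 2 / (eps * (ψ' w) ^ 2 + ψ'' w) := by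
      simp only [hg]; rw [h]; ring
    rw [this]; exact div_mul_cancel₀ _ hd.ne'
  have hgpos : ∀ w ∈ Set.Ico b ws, 0 < g w := by
    intro w hw
    have h := hgeq w hw
    have hd := hdenom w hw
    have hn := hψ'neg w hw
    have : 0 < R * (ψ' w) ^ 2 := mul_pos hRpos (sq_pos_of_neg hn)
    rw [← h] at this
    exact pos_of_mul_pos_left this hd.le
  have hgd : ∀ w ∈ Set.Ico b ws, HasDerivWithinAt g
      ((r * w - c) * ψ'' w + (r - lam) * ψ' w) (Set.Icc b ws) w := by
    intro w hw
    have h0 : HasDerivWithinAt (fun w : ℝ => r * w - c) r (Set.Icc b ws) w := by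
      simpa using (((hasDerivAt_id w).const_mul r).sub_const c).hasDerivWithinAt
    refine ((h0.mul (hd2 w hw)).sub
      ((hd1 w (Set.Ico_subset_Icc_self hw)).const_mul lam)).congr_deriv ?_
    ring
  have hsign : ∀ w ∈ Set.Ico b ws, g w * ψ'' w = (R - eps * g w) * (ψ' w) ^ 2 := by
    intro w hw
    linarith [hgeq w hw]
  -- the maximum argument
  have key : ∀ w ∈ Set.Ico b ws, ψ'' w ≤ 0 → (ψ'' w < 0 ∨ r < lam) → False := by
    intro w hw hle hor
    obtain ⟨m, hm, hmax⟩ := (isCompact_Icc (a := w) (b := ws)).exists_isMaxOn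
      ⟨w, le_refl _, hw.2.le⟩ (hgc.mono (Set.Icc_subset_Icc_left hw.1))
    have hgm : g w ≤ g m := hmax ⟨le_refl _, hw.2.le⟩
    have hgw := hgpos w hw
    have hmws : m < ws := by
      rcases lt_or_eq_of_le hm.2 with h | h
      · exact h
      · rw [h, hgws] at hgm; linarith
    have hmI : m ∈ Set.Ico b ws := ⟨hw.1.trans hm.1, hmws⟩
    have hpw : 0 < (ψ' w) ^ 2 := sq_pos_of_neg (hψ'neg w hw)
    have hnm := hψ'neg m hmI
    have hpm : 0 < (ψ' m) ^ 2 := sq_pos_of_neg hnm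
    have hgmp := hgpos m hmI
    have hmono : eps * g w ≤ eps * g m := mul_le_mul_of_nonneg_left hgm heps
    have h1 : R - eps * g m ≤ 0 := by
      have : R - eps * g w ≤ 0 := by
        by_contra hcon
        push Not at hcon
        have := mul_pos hcon hpw
        rw [← hsign w hw] at this
        nlinarith
      linarith
    have hm2 : ψ'' m ≤ 0 := by
      by_contra hcon
      push Not at hcon
      have := mul_pos hgmp hcon
      rw [hsign m hmI] at this
      nlinarith
    have hdpos : 0 < (r * m - c) * ψ'' m + (r - lam) * ψ' m := by
      have hrm : r * m - c < 0 := by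
        rw [hcr]; nlinarith
      rcases hor with h | h
      · have h3 : R - eps * g w < 0 := by
          by_contra hcon
          push Not at hcon
          have := mul_nonneg hcon hpw.le
          rw [← hsign w hw] at this
          nlinarith
        have h4 : ψ'' m < 0 := by
          by_contra hcon
          push Not at hcon
          have := mul_nonneg hgmp.le hcon
          rw [hsign m hmI] at this
          nlinarith
        have := mul_pos_of_neg_of_neg hrm h4
        have := mul_nonneg_of_nonpos_of_nonpos (by linarith : r - lam ≤ 0) hnm.le
        linarith
      · have := mul_nonneg_of_nonpos_of_nonpos hrm.le hm2
        have := mul_pos_of_neg_of_neg (by linarith : r - lam < 0) hnm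
        linarith
    have hdI : HasDerivWithinAt g ((r * m - c) * ψ'' m + (r - lam) * ψ' m) (Set.Ioo m ws) m :=
      (hgd m hmI).mono (fun x hx => ⟨hmI.1.trans hx.1.le, hx.2.le⟩)
    rw [hasDerivWithinAt_iff_tendsto_slope' (by simp)] at hdI
    have hne : (nhdsWithin m (Set.Ioo m ws)).NeBot := by
      rw [nhdsWithin_Ioo_eq_nhdsGT hmws]; infer_instance
    obtain ⟨z, hz1, hz2⟩ := ((hdI.eventually (lt_mem_nhds hdpos)).and
      self_mem_nhdsWithin).exists
    have hz3 : g z ≤ g m := hmax ⟨hm.1.trans hz2.1.le, hz2.2.le⟩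
    rw [slope_def_field] at hz1
    have : (g z - g m) / (z - m) ≤ 0 :=
      div_nonpos_of_nonpos_of_nonneg (by linarith) (by linarith [hz2.1])
    linarith
  have hint : ∀ x ∈ Set.Ioo b ws, Set.Icc b ws ∈ nhds x := fun x hx => Icc_mem_nhds hx.1 hx.2
  constructor
  · refine convexOn_of_hasDerivWithinAt2_nonneg (f' := ψ') (f'' := ψ'') (convex_Icc b ws)
      hψ1.continuousOn ?_ ?_ ?_
    · rw [interior_Icc]
      exact fun x hx => (hd1 x (Set.Ioo_subset_Icc_self hx)).mono Set.Ioo_subset_Icc_self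
    · rw [interior_Icc]
      exact fun x hx => (hd2 x (Set.Ioo_subset_Ico_self hx)).mono Set.Ioo_subset_Icc_self
    · rw [interior_Icc]
      intro x hx
      by_contra hcon
      push Not at hcon
      exact key x (Set.Ioo_subset_Ico_self hx) hcon.le (Or.inl hcon)
  · intro hlt
    refine strictConvexOn_of_deriv2_pos (convex_Icc b ws) hψ1.continuousOn ?_
    rw [interior_Icc]
    intro x hx
    have h1 : deriv ψ =ᶠ[nhds x] ψ' := by
      filter_upwards [Ioo_mem_nhds hx.1 hx.2] with y hy
      exact ((hd1 y (Set.Ioo_subset_Icc_self hy)).hasDerivAt (hint y hy)).deriv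
    have h2 : deriv^[2] ψ x = ψ'' x := by
      change deriv (deriv ψ) x = ψ'' x
      rw [h1.deriv_eq]
      exact ((hd2 x (Set.Ioo_subset_Ico_self hx)).hasDerivAt (hint x hx)).deriv
    rw [h2]
    by_contra hcon
    push Not at hcon
    exact key x (Set.Ioo_subset_Ico_self hx) hcon (Or.inr hlt)
end

section
/- Let λ > 0, ε > 0, and suppose r > λ. Let ψ be continuously differentiable on [b, w_s] and twice continuously differentiable on [b, w_s), with ψ(b) = 1, ψ(w_s) = 0, ψ'(w) < 0 and ε·ψ'(w)² + ψ''(w) > 0 for all w ∈ [b, w_s), solving λ·ψ(w) = − R·ψ'(w)²/(ε·ψ'(w)² + ψ''(w)) + (r w − c)·ψ'(w) for all w ∈ [b, w_s), and satisfying ψ(w) ≥ ψ₀(w) := ((c − r w)/(c − r b))^d on [b, w_s]. Then: (1) either ψ is strictly convex on [b, w_s], or there is a unique point w₀ ∈ (b, w_s) with (r w₀ − c)·ψ'(w₀) − λ·ψ(w₀) = R/ε, in which case ψ is strictly concave on [b, w₀) and strictly convex on (w₀, w_s]; (2) if ε ≤ R/(r d − λ), then ψ is strictly convex on [b, w_s];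 (3) if ε > R/(r − λ), then the second alternative in (1) holds. -/
set_option maxHeartbeats 2000000 in
/-- When r > λ, the robust value function changes concavity at most once,
is strictly convex for small ε, and changes concavity exactly once for large ε. -/
theorem stmt_17 (r μ σ c b ws R lam eps d : ℝ)
    (hr : 0 < r) (hμ : r < μ) (hσ : 0 < σ) (hc : 0 < c)
    (hws : ws = c / r) (hb : b < ws)
    (hR : R = (1 / 2) * ((μ - r) / σ) ^ 2)
    (hlam : 0 < lam) (heps : 0 < eps)
    (hrlam : lam < r)
    (hd : d = (1 / (2 * r)) *
      ((r + lam + R) + Real.sqrt ((r + lam + R) ^ 2 - 4 * r * lam)))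
    (ψ ψ' ψ'' : ℝ → ℝ)
    (hψ' : ψ' = derivWithin ψ (Set.Icc b ws))
    (hψ'' : ψ'' = derivWithin ψ' (Set.Icc b ws))
    (hψ1 : ContDiffOn ℝ 1 ψ (Set.Icc b ws))
    (hψ2 : ContDiffOn ℝ 2 ψ (Set.Ico b ws))
    (hψb : ψ b = 1) (hψws : ψ ws = 0)
    (hψ'neg : ∀ w ∈ Set.Ico b ws, ψ' w < 0)
    (hdenom : ∀ w ∈ Set.Ico b ws, 0 < eps * (ψ' w) ^ 2 + ψ'' w)
    (hode : ∀ w ∈ Set.Ico b ws,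
      lam * ψ w = - R * (ψ' w) ^ 2 / (eps * (ψ' w) ^ 2 + ψ'' w) + (r * w - c) * ψ' w)
    (hlower : ∀ w ∈ Set.Icc b ws, ((c - r * w) / (c - r * b)) ^ d ≤ ψ w) :
    (StrictConvexOn ℝ (Set.Icc b ws) ψ ∨
      (∃ w₀ ∈ Set.Ioo b ws,
        (r * w₀ - c) * ψ' w₀ - lam * ψ w₀ = R / eps ∧
        (∀ w ∈ Set.Ioo b ws, (r * w - c) * ψ' w - lam * ψ w = R / eps → w = w₀) ∧
        StrictConcaveOn ℝ (Set.Ico b w₀) ψ ∧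
        StrictConvexOn ℝ (Set.Ioc w₀ ws) ψ)) ∧
    (eps ≤ R / (r * d - lam) → StrictConvexOn ℝ (Set.Icc b ws) ψ) ∧
    (R / (r - lam) < eps →
      ∃ w₀ ∈ Set.Ioo b ws,
        (r * w₀ - c) * ψ' w₀ - lam * ψ w₀ = R / eps ∧
        (∀ w ∈ Set.Ioo b ws, (r * w - c) * ψ' w - lam * ψ w = R / eps → w = w₀) ∧
        StrictConcaveOn ℝ (Set.Ico b w₀) ψ ∧
        StrictConvexOn ℝ (Set.Ioc w₀ ws) ψ) := by
  have hRpos : 0 < R := by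
    rw [hR]; have : 0 < (μ - r) / σ := div_pos (by linarith) hσ
    positivity
  have hrws : r * ws = c := by rw [hws]; field_simp
  have hneg : ∀ w, w < ws → r * w - c < 0 := by
    intro w hw; nlinarith
  have hKpos : 0 < R / eps := div_pos hRpos heps
  -- derivatives
  have hD1 : ∀ w ∈ Set.Icc b ws, HasDerivWithinAt ψ (ψ' w) (Set.Icc b ws) w := by
    intro w hw
    rw [hψ']
    exact ((hψ1.differentiableOn (by norm_num)) w hw).hasDerivWithinAt
  have hC1 : ContinuousOn ψ' (Set.Icc b ws) := by
    rw [hψ']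
    exact hψ1.continuousOn_derivWithin (uniqueDiffOn_Icc hb) le_rfl
  have hC0 : ContinuousOn ψ (Set.Icc b ws) := hψ1.continuousOn
  have hnhds : ∀ w ∈ Set.Ico b ws, Set.Ico b ws =ᶠ[nhds w] Set.Icc b ws := by
    intro w hw
    filter_upwards [Iio_mem_nhds hw.2] with x hx
    have hx' : x < ws := hx
    apply propext
    exact ⟨fun h => ⟨h.1, h.2.le⟩, fun h => ⟨h.1, hx'⟩⟩
  have hD2 : ∀ w ∈ Set.Ico b ws, HasDerivWithinAt ψ' (ψ'' w) (Set.Icc b ws) w := by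
    intro w hw
    have h1 : DifferentiableOn ℝ (derivWithin ψ (Set.Ico b ws)) (Set.Ico b ws) :=
      (hψ2.derivWithin (m := 1) (uniqueDiffOn_Ico b ws) (by norm_num)).differentiableOn (by norm_num)
    have h2 : DifferentiableWithinAt ℝ ψ' (Set.Ico b ws) w := by
      refine (h1 w hw).congr (fun x hx => ?_) ?_
      · rw [hψ']; exact (derivWithin_congr_set (hnhds x hx)).symm
      · rw [hψ']; exact (derivWithin_congr_set (hnhds w hw)).symm
    have h3 : DifferentiableWithinAt ℝ ψ' (Set.Icc b ws) w :=
      (differentiableWithinAt_congr_set (hnhds w hw)).1 h2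
    rw [hψ'']
    exact h3.hasDerivWithinAt
  have hG : ∀ w ∈ Set.Ico b ws, ((r * w - c) * ψ' w - lam * ψ w) * (eps * (ψ' w) ^ 2 + ψ'' w)
      = R * (ψ' w) ^ 2 := by
    intro w hw
    have h1 := hode w hw
    have h2 := hdenom w hw
    have h3 : (r * w - c) * ψ' w - lam * ψ w = R * (ψ' w) ^ 2 / (eps * (ψ' w) ^ 2 + ψ'' w) := by
      rw [h1]; ring
    rw [h3]; exact div_mul_cancel₀ _ h2.ne'
  obtain ⟨G, hGdef⟩ : ∃ G : ℝ → ℝ, ∀ w, G w = (r * w - c) * ψ' w - lam * ψ w :=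
    ⟨fun w => (r * w - c) * ψ' w - lam * ψ w, fun _ => rfl⟩
  simp only [← hGdef] at hG ⊢
  have hGfun : G = fun w => (r * w - c) * ψ' w - lam * ψ w := funext hGdef
  have hle : ∀ w ∈ Set.Ico b ws, G w ≤ R / eps → 0 ≤ ψ'' w := by
    intro w hw h
    have h1 := hG w hw
    have h2 := hdenom w hw
    have h3 := hψ'neg w hw
    rw [le_div_iff₀ heps] at h
    by_contra! hn
    have h4 : 0 < (ψ' w) ^ 2 := by nlinarith
    have h5 : 0 < G w := by
      by_contra! hh
      nlinarith [mul_pos hRpos h4]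
    nlinarith [mul_pos h5 (neg_pos.2 hn), mul_nonneg (sub_nonneg.2 h) h4.le]
  have hlt : ∀ w ∈ Set.Ico b ws, G w < R / eps → 0 < ψ'' w := by
    intro w hw h
    refine lt_of_le_of_ne (hle w hw h.le) fun h0 => ?_
    have h1 := hG w hw
    have h3 := hψ'neg w hw
    have h4 : 0 < (ψ' w) ^ 2 := by nlinarith
    rw [lt_div_iff₀ heps] at h
    rw [← h0] at h1
    nlinarith [mul_pos (sub_pos.2 h) h4]
  have hgt : ∀ w ∈ Set.Ico b ws, R / eps < G w → ψ'' w < 0 := by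
    intro w hw h
    have h1 := hG w hw
    have h3 := hψ'neg w hw
    have h4 : 0 < (ψ' w) ^ 2 := by nlinarith
    have h5 : 0 < G w := hKpos.trans h
    rw [div_lt_iff₀ heps] at h
    by_contra! hn
    nlinarith [mul_nonneg h5.le hn, mul_pos (sub_pos.2 h) h4]
  have hGC : ContinuousOn G (Set.Icc b ws) := by
    rw [hGfun]; fun_prop
  have hGD : ∀ w ∈ Set.Ico b ws,
      HasDerivWithinAt G ((r - lam) * ψ' w + (r * w - c) * ψ'' w) (Set.Icc b ws) w := by
    intro w hw
    have h1 : HasDerivWithinAt (fun w => r * w - c) r (Set.Icc b ws) w := by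
      simpa using ((hasDerivWithinAt_id w (Set.Icc b ws)).const_mul r).sub_const c
    have h2 := (h1.mul (hD2 w hw)).sub ((hD1 w ⟨hw.1, hw.2.le⟩).const_mul lam)
    rw [hGfun]
    refine h2.congr_deriv ?_
    ring
  have hGneg : ∀ w ∈ Set.Ico b ws, G w ≤ R / eps →
      (r - lam) * ψ' w + (r * w - c) * ψ'' w < 0 := by
    intro w hw h
    have h1 := hle w hw h
    have h2 := hneg w hw.2
    have h3 := hψ'neg w hw
    nlinarith [mul_nonneg (neg_pos.2 h2).le h1, mul_pos (sub_pos.2 hrlam) (neg_pos.2 h3)]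
  have hcross : ∀ w1 w2, b ≤ w1 → w1 < w2 → w2 < ws → G w1 ≤ R / eps → G w2 < R / eps := by
    intro w1 w2 hb1 h12 h2s hw1
    have hsub : Set.Icc w1 w2 ⊆ Set.Icc b ws := Set.Icc_subset_Icc hb1 h2s.le
    have hA : ∀ x ∈ Set.Icc w1 w2, G x ≤ R / eps := by
      intro x hx
      refine image_le_of_deriv_right_lt_deriv_boundary (f := G)
        (f' := fun w => (r - lam) * ψ' w + (r * w - c) * ψ'' w)
        (B := fun _ => R / eps) (B' := fun _ => 0) (hGC.mono hsub) ?_ hw1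
        (fun x => hasDerivAt_const x _) ?_ hx
      · intro y hy
        have hy' : y ∈ Set.Ico b ws := ⟨hb1.trans hy.1, hy.2.trans h2s⟩
        refine (hGD y hy').mono_of_mem_nhdsWithin ?_
        exact Filter.mem_of_superset (Icc_mem_nhdsGE hy'.2) (Set.Icc_subset_Icc_left hy'.1)
      · intro y hy he
        exact hGneg y ⟨hb1.trans hy.1, hy.2.trans h2s⟩ he.le
    have hanti : StrictAntiOn G (Set.Icc w1 w2) := by
      refine strictAntiOn_of_deriv_neg (convex_Icc _ _) (hGC.mono hsub) ?_
      intro x hx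
      rw [interior_Icc] at hx
      have hx' : x ∈ Set.Ico b ws := ⟨hb1.trans hx.1.le, hx.2.trans h2s⟩
      have := (hGD x hx').hasDerivAt (Icc_mem_nhds (hb1.trans_lt hx.1) hx'.2)
      rw [this.deriv]
      exact hGneg x hx' (hA x ⟨hx.1.le, hx.2.le⟩)
    exact (hanti ⟨le_rfl, h12.le⟩ ⟨h12.le, le_rfl⟩ h12).trans_le hw1
  have hderiv2 : ∀ w ∈ Set.Ioo b ws, deriv^[2] ψ w = ψ'' w := by
    intro w hw
    have h1 : deriv ψ =ᶠ[nhds w] ψ' := by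
      filter_upwards [Ioo_mem_nhds hw.1 hw.2] with x hx
      exact ((hD1 x ⟨hx.1.le, hx.2.le⟩).hasDerivAt (Icc_mem_nhds hx.1 hx.2)).deriv
    have h2 := (hD2 w ⟨hw.1.le, hw.2⟩).hasDerivAt (Icc_mem_nhds hw.1 hw.2)
    simp only [Function.iterate_succ, Function.iterate_zero, Function.comp, id]
    rw [h1.deriv_eq, h2.deriv]
  have hGws : G ws = 0 := by rw [hGdef, hψws, hrws]; ring
  -- convex case
  have hconvex : G b ≤ R / eps → StrictConvexOn ℝ (Set.Icc b ws) ψ := by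
    intro h
    refine strictConvexOn_of_deriv2_pos (convex_Icc _ _) hC0 ?_
    intro x hx
    rw [interior_Icc] at hx
    rw [hderiv2 x hx]
    exact hlt x ⟨hx.1.le, hx.2⟩ (hcross b x le_rfl hx.1 hx.2 h)
  have hsecond : R / eps < G b → ∃ w₀ ∈ Set.Ioo b ws,
        G w₀ = R / eps ∧
        (∀ w ∈ Set.Ioo b ws, G w = R / eps → w = w₀) ∧
        StrictConcaveOn ℝ (Set.Ico b w₀) ψ ∧
        StrictConvexOn ℝ (Set.Ioc w₀ ws) ψ := by
    intro h
    obtain ⟨w₀, hw₀, he⟩ := intermediate_value_Ioo' hb.le hGC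
      (show R / eps ∈ Set.Ioo (G ws) (G b) from ⟨by rw [hGws]; exact hKpos, h⟩)
    refine ⟨w₀, hw₀, he, ?_, ?_, ?_⟩
    · intro w hw hwe
      rcases lt_trichotomy w w₀ with hl | hl | hl
      · have := hcross w w₀ hw.1.le hl hw₀.2 hwe.le
        linarith
      · exact hl
      · have := hcross w₀ w hw₀.1.le hl hw.2 he.le
        linarith
    · refine strictConcaveOn_of_deriv2_neg (convex_Ico _ _)
        (hC0.mono fun x hx => ⟨hx.1, hx.2.le.trans hw₀.2.le⟩) ?_
      intro x hx
      rw [interior_Ico] at hx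
      rw [hderiv2 x ⟨hx.1, hx.2.trans hw₀.2⟩]
      refine hgt x ⟨hx.1.le, hx.2.trans hw₀.2⟩ ?_
      by_contra! hn
      have := hcross x w₀ hx.1.le hx.2 hw₀.2 hn
      linarith
    · refine strictConvexOn_of_deriv2_pos (convex_Ioc _ _)
        (hC0.mono fun x hx => ⟨hw₀.1.le.trans hx.1.le, hx.2⟩) ?_
      intro x hx
      rw [interior_Ioc] at hx
      rw [hderiv2 x ⟨hw₀.1.trans hx.1, hx.2⟩]
      exact hlt x ⟨hw₀.1.le.trans hx.1.le, hx.2⟩ (hcross w₀ x hw₀.1.le hx.1 hx.2 he.le)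
  have hbb : b ∈ Set.Icc b ws := ⟨le_rfl, hb.le⟩
  have hcb : 0 < c - r * b := by linarith [hneg b hb]
  refine ⟨?_, ?_, ?_⟩
  · rcases le_or_gt (G b) (R / eps) with h | h
    · exact Or.inl (hconvex h)
    · exact Or.inr (hsecond h)
  · intro h
    apply hconvex
    have hs : r - lam ≤ Real.sqrt ((r + lam + R) ^ 2 - 4 * r * lam) := by
      apply Real.le_sqrt_of_sq_le
      nlinarith only [mul_pos hRpos hr, mul_pos hRpos hlam, sq_nonneg R]
    have hrd : r * d = (1 / 2) *
        ((r + lam + R) + Real.sqrt ((r + lam + R) ^ 2 - 4 * r * lam)) := by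
      rw [hd]; field_simp
    have hrd1 : r < r * d := by rw [hrd]; linarith
    have hd1 : 1 ≤ d := by
      by_contra! hh
      nlinarith
    have hK : r * d - lam ≤ R / eps := by
      rw [le_div_iff₀ (by linarith)] at h
      rw [le_div_iff₀ heps]; linarith
    have hsl : -(d * r / (c - r * b)) ≤ ψ' b := by
      have ht := hasDerivWithinAt_iff_tendsto_slope.1 (hD1 b hbb)
      have hne : (nhdsWithin b (Set.Icc b ws \ {b})).NeBot := by
        rw [Set.Icc_sdiff_left]
        exact left_nhdsWithin_Ioc_neBot hb
      refine ge_of_tendsto ht ?_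
      filter_upwards [self_mem_nhdsWithin] with x hx
      rw [Set.Icc_sdiff_left] at hx
      have hxb : 0 < x - b := sub_pos.2 hx.1
      have h1 := hlower x ⟨hx.1.le, hx.2⟩
      have h2 : (c - r * x) / (c - r * b) = 1 + (-(r * (x - b)) / (c - r * b)) := by
        field_simp; ring
      have h3 : -1 ≤ -(r * (x - b)) / (c - r * b) := by
        rw [le_div_iff₀ hcb]
        nlinarith [mul_le_mul_of_nonneg_left hx.2 hr.le]
      have h4 := one_add_mul_self_le_rpow_one_add h3 hd1
      rw [← h2] at h4
      rw [slope_def_field, le_div_iff₀ hxb, hψb]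
      have h5 : d * (-(r * (x - b)) / (c - r * b)) = -(d * r / (c - r * b)) * (x - b) := by
        ring
      linarith
    have hm : -(d * r) ≤ ψ' b * (c - r * b) := by
      have := mul_le_mul_of_nonneg_right hsl hcb.le
      have e : -(d * r / (c - r * b)) * (c - r * b) = -(d * r) := by field_simp
      linarith
    have : G b = -(ψ' b * (c - r * b)) - lam := by rw [hGdef, hψb]; ring
    linarith
  · intro h
    apply hsecond
    by_contra! hn
    have hcv := (hconvex hn).convexOn
    have hsl : ψ' b ≤ slope ψ b ws :=
      hcv.le_slope_of_hasDerivWithinAt hbb ⟨hb.le, le_rfl⟩ hb (hD1 b hbb)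
    rw [slope_def_field, hψb, hψws, le_div_iff₀ (sub_pos.2 hb)] at hsl
    have : G b = -(r * (ψ' b * (ws - b))) - lam := by
      rw [hGdef, hψb, ← hrws]; ring
    have h2 : r * (ψ' b * (ws - b)) ≤ r * (0 - 1) := mul_le_mul_of_nonneg_left hsl hr.le
    rw [div_lt_iff₀ (sub_pos.2 hrlam)] at h
    have h3 : R / eps < r - lam := by
      rw [div_lt_iff₀ heps]; linarith
    linarith
end

section
/- Let λ > 0. Define K := R·d²/((d − 1)²·(2 d r − λ) + 2 R d) and f₁(w) := K·[((c − r w)/(c − r b))^d − ((c − r w)/(c − r b))^{2d}] for w ∈ [b, w_s]. Then (d − 1)²·(2 d r − λ) + 2 R d > 0, f₁(b) = f₁(w_s) = 0, and f₁ satisfies the linear second-order differential equation f₁''(w) + A(w)·f₁'(w) + B(w)·f₁(w) + C(w) = 0 for all w ∈ (b, w_s), where A(w) := (r (d − 1)(2R − r d + r)/R)·1/(c − r w), B(w) := (−λ r² (d − 1)²/R)·1/(c − r w)², and C(w) := (r² d²/(c − r b)^{2d})·(c − r w)^{2d − 2}. -/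
theorem aux_deriv (r c X p w : ℝ) (hX : 0 < X) (hw : 0 < c - r * w) :
    HasDerivAt (fun w => ((c - r * w) / X) ^ p)
      (-(r * p) * (((c - r * w) / X) ^ p / (c - r * w))) w := by
  have h1 : HasDerivAt (fun w => (c - r * w) / X) (-r / X) w := by
    have h := (((hasDerivAt_id w).const_mul r).const_sub c).div_const X
    simpa using h
  have hpos : 0 < (c - r * w) / X := div_pos hw hX
  have h2 := h1.rpow_const (p := p) (Or.inl hpos.ne')
  convert h2 using 1
  rw [Real.rpow_sub_one hpos.ne']
  field_simp

theorem aux_deriv2 (r c X p w : ℝ) (hX : 0 < X) (hw : 0 < c - r * w) :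
    HasDerivAt (fun w => -(r * p) * (((c - r * w) / X) ^ p / (c - r * w)))
      (r ^ 2 * p * (p - 1) * (((c - r * w) / X) ^ p / (c - r * w) ^ 2)) w := by
  have h1 : HasDerivAt (fun w => (c - r * w)) (-r) w := by
    have h := (((hasDerivAt_id w).const_mul r).const_sub c)
    simpa using h
  have h2 := ((aux_deriv r c X p w hX hw).div h1 hw.ne').const_mul (-(r * p))
  refine h2.congr_deriv ?_
  generalize ((c - r * w) / X) ^ p = U
  generalize c - r * w = x at *
  field_simp
  ring

/-- The explicit first-order correction f₁ of the small-ε expansion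
satisfies the homogeneous boundary conditions and the linear second-order ODE. -/
theorem stmt_18 (r μ σ c b ws R lam d K : ℝ)
    (hr : 0 < r) (hμ : r < μ) (hσ : 0 < σ) (hc : 0 < c)
    (hws : ws = c / r) (hb : b < ws)
    (hR : R = (1 / 2) * ((μ - r) / σ) ^ 2)
    (hlam : 0 < lam)
    (hd : d = (1 / (2 * r)) *
      ((r + lam + R) + Real.sqrt ((r + lam + R) ^ 2 - 4 * r * lam)))
    (hK : K = R * d ^ 2 / ((d - 1) ^ 2 * (2 * d * r - lam) + 2 * R * d))
    (f₁ : ℝ → ℝ)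
    (hf₁ : ∀ w, f₁ w = K *
      (((c - r * w) / (c - r * b)) ^ d - ((c - r * w) / (c - r * b)) ^ (2 * d)))
    (A B C : ℝ → ℝ)
    (hA : ∀ w, A w = (r * (d - 1) * (2 * R - r * d + r) / R) * (1 / (c - r * w)))
    (hB : ∀ w, B w = (-lam * r ^ 2 * (d - 1) ^ 2 / R) * (1 / (c - r * w) ^ 2))
    (hC : ∀ w, C w = (r ^ 2 * d ^ 2 / (c - r * b) ^ (2 * d)) * (c - r * w) ^ (2 * d - 2)) :
    0 < (d - 1) ^ 2 * (2 * d * r - lam) + 2 * R * d ∧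
    f₁ b = 0 ∧ f₁ ws = 0 ∧
    (∀ w ∈ Set.Ioo b ws,
      deriv (deriv f₁) w + A w * deriv f₁ w + B w * f₁ w + C w = 0) := by
  have hR0 : 0 < R := by
    rw [hR]
    have : 0 < (μ - r) / σ := div_pos (by linarith) hσ
    positivity
  have hdisc : 0 ≤ (r + lam + R) ^ 2 - 4 * r * lam := by
    nlinarith [sq_nonneg (r - lam), mul_pos hR0 hr, mul_pos hR0 hlam, mul_pos hR0 hR0]
  have hsq := Real.sq_sqrt hdisc
  have hs0 := Real.sqrt_nonneg ((r + lam + R) ^ 2 - 4 * r * lam)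
  have hs1 : r - lam - R < Real.sqrt ((r + lam + R) ^ 2 - 4 * r * lam) := by
    apply Real.lt_sqrt_of_sq_lt
    nlinarith [mul_pos hR0 hr]
  generalize Real.sqrt ((r + lam + R) ^ 2 - 4 * r * lam) = s at *
  have hd2 : 2 * r * d = r + lam + R + s := by
    rw [hd]; field_simp
  have hd1 : 1 < d := by
    by_contra h
    nlinarith
  have hquad : r * d ^ 2 - (r + lam + R) * d + lam = 0 := by
    have hs : s = 2 * r * d - (r + lam + R) := by linarith
    rw [hs] at hsq
    have : 4 * r * (r * d ^ 2 - (r + lam + R) * d + lam) = 0 := by linarith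
    rcases mul_eq_zero.mp this with h | h
    · linarith
    · exact h
  have hrd : lam < r * d := by
    by_contra h
    nlinarith [mul_pos hR0 (by linarith : 0 < d),
      mul_nonneg (by linarith : 0 ≤ d - 1) (by linarith : 0 ≤ lam - r * d)]
  have hD : 0 < (d - 1) ^ 2 * (2 * d * r - lam) + 2 * R * d := by
    have h1 : 0 < d - 1 := by linarith
    have h2 : 0 < 2 * d * r - lam := by nlinarith
    have h3 : 0 < d := by linarith
    positivity
  have hrws : r * ws = c := by rw [hws]; field_simp
  have hX : 0 < c - r * b := by nlinarith
  refine ⟨hD, ?_, ?_, ?_⟩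
  · rw [hf₁, div_self hX.ne']; simp
  · rw [hf₁, hrws, sub_self, zero_div, Real.zero_rpow (by linarith),
      Real.zero_rpow (by linarith)]; simp
  · intro w hw
    have hpos : ∀ v, v < ws → 0 < c - r * v := fun v hv => by nlinarith
    have hf : f₁ = fun w => K *
      (((c - r * w) / (c - r * b)) ^ d - ((c - r * w) / (c - r * b)) ^ (2 * d)) := funext hf₁
    have hder : ∀ v, v < ws → deriv f₁ v = K *
        (-(r * d) * (((c - r * v) / (c - r * b)) ^ d / (c - r * v)) -
        -(r * (2 * d)) * (((c - r * v) / (c - r * b)) ^ (2 * d) / (c - r * v))) := by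
      intro v hv
      rw [hf]
      exact (((aux_deriv r c _ d v hX (hpos v hv)).sub
        (aux_deriv r c _ (2 * d) v hX (hpos v hv))).const_mul K).deriv
    have hx := hpos w hw.2
    have hder2 : deriv (deriv f₁) w = K *
        (r ^ 2 * d * (d - 1) * (((c - r * w) / (c - r * b)) ^ d / (c - r * w) ^ 2) -
        r ^ 2 * (2 * d) * (2 * d - 1) *
          (((c - r * w) / (c - r * b)) ^ (2 * d) / (c - r * w) ^ 2)) := by
      have he : deriv f₁ =ᶠ[nhds w] fun v => K *
        (-(r * d) * (((c - r * v) / (c - r * b)) ^ d / (c - r * v)) -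
        -(r * (2 * d)) * (((c - r * v) / (c - r * b)) ^ (2 * d) / (c - r * v))) := by
        filter_upwards [Iio_mem_nhds hw.2] with v hv using hder v hv
      rw [he.deriv_eq]
      exact (((aux_deriv2 r c _ d w hX hx).sub
        (aux_deriv2 r c _ (2 * d) w hX hx)).const_mul K).deriv
    have hCw : C w = r ^ 2 * d ^ 2 *
        (((c - r * w) / (c - r * b)) ^ (2 * d) / (c - r * w) ^ 2) := by
      rw [hC, Real.div_rpow hx.le hX.le, Real.rpow_sub hx, Real.rpow_two]
      ring
    rw [hder2, hder w hw.2, hCw, hA, hB, hf₁]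
    have hKD : K * ((d - 1) ^ 2 * (2 * d * r - lam) + 2 * R * d) = R * d ^ 2 := by
      rw [hK]; exact div_mul_cancel₀ _ hD.ne'
    generalize ((c - r * w) / (c - r * b)) ^ d = U
    generalize ((c - r * w) / (c - r * b)) ^ (2 * d) = V
    generalize c - r * w = x at *
    clear hK hd
    field_simp
    linear_combination (r ^ 2 * K * U * (d - 1)) * hquad - r ^ 2 * V * hKD
end

section
/- Let λ > 0 and let ψ₀(w) := ((c − r w)/(c − r b))^d, K := R·d²/((d − 1)²·(2 d r − λ) + 2 R d), and f₁(w) := K·(ψ₀(w) − ψ₀(w)²) on [b, w_s]. Then there exist constants C > 0 and ε₀ > 0 such that for every ε ∈ (0, ε₀) the following holds: if ψ is continuously differentiable on [b, w_s] and twice continuously differentiable on [b, w_s), with ψ(b) = 1, ψ(w_s) = 0, 0 ≤ ψ ≤ 1 on [b, w_s], ψ'(w) < 0 and ε·ψ'(w)² + ψ''(w) > 0 for all w ∈ [b, w_s), and ψ solves λ·ψ(w) = − R·ψ'(w)²/(ε·ψ'(w)² + ψ''(w)) + (r w − c)·ψ'(w) for all w ∈ (b, w_s), then sup_{w ∈ [b,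 w_s]} |ψ(w) − ψ₀(w) − ε·f₁(w)| ≤ C·ε². -/
/-- Maximum principle: no positive interior critical maximum. -/
theorem aux_maxp (b ws : ℝ) (hb : b < ws) (h h1 h2 : ℝ → ℝ)
    (hc : ContinuousOn h (Set.Icc b ws)) (hb0 : h b ≤ 0) (hw0 : h ws ≤ 0)
    (hd1 : ∀ w ∈ Set.Ioo b ws, HasDerivAt h (h1 w) w)
    (hd2 : ∀ w ∈ Set.Ioo b ws, HasDerivAt h1 (h2 w) w)
    (hF : ∀ w ∈ Set.Ioo b ws, 0 < h w → h1 w = 0 → h2 w ≤ 0 → False) :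
    ∀ w ∈ Set.Icc b ws, h w ≤ 0 := by
  obtain ⟨m, hm, hmax⟩ := isCompact_Icc.exists_isMaxOn (Set.nonempty_Icc.2 hb.le) hc
  intro w hw
  refine (hmax hw).trans ?_
  by_contra hpos
  push Not at hpos
  have hmi : m ∈ Set.Ioo b ws := by
    refine ⟨lt_of_le_of_ne hm.1 ?_, lt_of_le_of_ne hm.2 ?_⟩
    · rintro rfl; linarith
    · rintro rfl; linarith
  have hnhds : Set.Ioo b ws ∈ nhds m := isOpen_Ioo.mem_nhds hmi
  have hloc : IsLocalMax h m := hmax.isLocalMax (Icc_mem_nhds hmi.1 hmi.2)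
  have h10 : h1 m = 0 := hloc.hasDerivAt_eq_zero (hd1 m hmi)
  refine hF m hmi hpos h10 ?_
  by_contra hp
  push Not at hp
  have hev : deriv h =ᶠ[nhds m] h1 := by
    filter_upwards [hnhds] with x hx
    exact (hd1 x hx).deriv
  have hdd : deriv (deriv h) m = h2 m := by
    rw [hev.deriv_eq]; exact (hd2 m hmi).deriv
  have hmin : IsLocalMin h m := by
    apply isLocalMin_of_deriv_deriv_pos
    · rw [hdd]; exact hp
    · rw [(hd1 m hmi).deriv]; exact h10
    · exact (hd1 m hmi).continuousAt
  have hconst : h =ᶠ[nhds m] fun _ => h m := by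
    filter_upwards [hloc, hmin] with x hx hx'
    exact le_antisymm hx hx'
  have h1z : deriv h =ᶠ[nhds m] fun _ => (0:ℝ) := by
    have := hconst.deriv
    filter_upwards [this] with x hx
    rw [hx]; simp
  have : deriv (deriv h) m = 0 := by rw [h1z.deriv_eq]; simp
  linarith

theorem aux_bounds (e d κ K lam a eps y P S B : ℝ)
    (he : 0 < e) (hd : 0 < d) (hκ : 0 < κ) (hK : 0 < K) (hlam : 0 < lam)
    (heps : 0 < eps) (ha0 : 0 ≤ a) (ha1 : a ≤ 2 * K * eps) (ha2 : 4 * K * eps ≤ 1)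
    (hy0 : 0 ≤ y) (hy1 : y ≤ 1)
    (hP : P = 1 + a * (1 - 2 * y)) (hS : S = -2 * a + eps * P ^ 2)
    (hB : B = 9 * e * κ * K + 2 * lam * K * d * (4 * K + 3)) :
    1 / 2 ≤ P ∧ |S| ≤ (4 * K + 3) * eps ∧
    |e * P * (κ * eps * (1 - P ^ 2)) + lam * a * d * y * S| ≤ B * eps ^ 2 := by
  have hz : |a * (1 - 2 * y)| ≤ a := by
    rw [abs_le]; constructor <;> nlinarith
  obtain ⟨hz1, hz2⟩ := abs_le.1 hz
  have haa : a ≤ 1 / 2 := by linarith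
  have hP1 : 1 / 2 ≤ P := by linarith
  have hP2 : P ≤ 3 / 2 := by linarith
  have hPsq : P ^ 2 ≤ 3 := by nlinarith
  have hSb : |S| ≤ (4 * K + 3) * eps := by
    rw [abs_le]; constructor <;> nlinarith [sq_nonneg P, mul_pos hK heps, mul_nonneg heps.le (sq_nonneg P)]
  refine ⟨hP1, hSb, ?_⟩
  have h1P : |1 - P ^ 2| ≤ 6 * K * eps := by
    have : |1 - P ^ 2| = |a * (1 - 2 * y)| * |1 + P| := by
      rw [← abs_mul, ← abs_neg (1 - P ^ 2)]; congr 1; rw [hP]; ring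
    rw [this, abs_of_pos (by linarith : 0 < 1 + P)]
    nlinarith [abs_nonneg (a * (1 - 2 * y))]
  have t1 : |e * P * (κ * eps * (1 - P ^ 2))| ≤ 9 * e * κ * K * eps ^ 2 := by
    have : |e * P * (κ * eps * (1 - P ^ 2))| = (e * κ * eps) * (P * |1 - P ^ 2|) := by
      rw [abs_mul, abs_mul, abs_mul, abs_of_pos he, abs_of_pos (by linarith : 0 < P),
        abs_of_pos (by positivity : 0 < κ * eps)]; ring
    rw [this]
    have : P * |1 - P ^ 2| ≤ (3 / 2) * (6 * K * eps) :=
      mul_le_mul hP2 h1P (abs_nonneg _) (by norm_num)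
    calc (e * κ * eps) * (P * |1 - P ^ 2|) ≤ (e * κ * eps) * ((3 / 2) * (6 * K * eps)) :=
          mul_le_mul_of_nonneg_left this (by positivity)
      _ = _ := by ring
  have t2 : |lam * a * d * y * S| ≤ 2 * lam * K * d * (4 * K + 3) * eps ^ 2 := by
    have h3 : |lam * a * d * y * S| = lam * d * (a * (y * |S|)) := by
      rw [abs_mul, abs_of_nonneg (by positivity : 0 ≤ lam * a * d * y)]; ring
    rw [h3]
    have h4 : y * |S| ≤ 1 * ((4 * K + 3) * eps) := mul_le_mul hy1 hSb (abs_nonneg _) (by norm_num)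
    have h5 : a * (y * |S|) ≤ (2 * K * eps) * (1 * ((4 * K + 3) * eps)) :=
      mul_le_mul ha1 h4 (by positivity) (by positivity)
    calc lam * d * (a * (y * |S|)) ≤ lam * d * ((2 * K * eps) * (1 * ((4 * K + 3) * eps))) :=
          mul_le_mul_of_nonneg_left h5 (by positivity)
      _ = _ := by ring
  calc _ ≤ _ := abs_add_le _ _
    _ ≤ _ := add_le_add t1 t2
    _ = _ := by rw [hB]; ring

/-- The residual identity. -/
theorem aux_resid (r R lam d e κ Λ a eps y P S : ℝ) (he0 : e ≠ 0) (he : e = d - 1)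
    (hroot : r * d ^ 2 - (r + lam + R) * d + lam = 0)
    (hκ : κ = R * d ^ 2 / e ^ 2) (hΛ : Λ = lam + 2 * κ)
    (hP : P = 1 + a * (1 - 2 * y)) (hS : S = -2 * a + eps * P ^ 2) :
    (lam * (y + a * (y - y ^ 2)) - r * d * y * P) * (e * P + d * y * S) + R * d * y * P ^ 2
      = y ^ 2 * (e * P * (Λ * a - κ * eps * P ^ 2) + lam * a * d * y * S) := by
  have h1 : r * d = lam + R * d / e := by
    field_simp
    rw [he]; linarith
  have h2 : lam * (y + a * (y - y ^ 2)) - r * d * y * P = lam * a * y ^ 2 - R * d / e * y * P := by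
    rw [h1, hP]; ring
  have h3 : Λ * a - κ * eps * P ^ 2 = lam * a - κ * S := by
    rw [hΛ, hS]; ring
  rw [h2, h3, hκ]
  field_simp
  ring

theorem aux_d (r R lam d : ℝ) (hr : 0 < r) (hR : 0 < R) (hlam : 0 < lam)
    (hd : d = (1 / (2 * r)) *
      ((r + lam + R) + Real.sqrt ((r + lam + R) ^ 2 - 4 * r * lam))) :
    1 < d ∧ r * d ^ 2 - (r + lam + R) * d + lam = 0 := by
  have hdisc : 0 ≤ (r + lam + R) ^ 2 - 4 * r * lam := by
    nlinarith [sq_nonneg (r - lam), mul_pos hr hR, mul_pos hlam hR, sq_nonneg R]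
  have hsq := Real.sq_sqrt hdisc
  have hs0 := Real.sqrt_nonneg ((r + lam + R) ^ 2 - 4 * r * lam)
  have hlt : r - lam - R < Real.sqrt ((r + lam + R) ^ 2 - 4 * r * lam) := by
    apply Real.lt_sqrt_of_sq_lt
    nlinarith [mul_pos hr hR]
  set s := Real.sqrt ((r + lam + R) ^ 2 - 4 * r * lam)
  have hs : s = 2 * r * d - (r + lam + R) := by rw [hd]; field_simp; ring
  constructor
  · nlinarith
  · rw [hs] at hsq
    have : 4 * r * (r * d ^ 2 - (r + lam + R) * d + lam) = 0 := by linarith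
    rcases mul_eq_zero.1 this with h | h
    · linarith
    · exact h

theorem aux_psi0 (r c b ws d w : ℝ) (hr : 0 < r) (hws : ws = c / r) (hb : b < ws) (hw : w < ws) :
    0 < c - r * w ∧
    HasDerivAt (fun w => ((c - r * w) / (c - r * b)) ^ d)
      (-(r * d) * ((c - r * w) / (c - r * b)) ^ d / (c - r * w)) w ∧
    HasDerivAt (fun w => -(r * d) * ((c - r * w) / (c - r * b)) ^ d / (c - r * w))
      (r ^ 2 * d * (d - 1) * ((c - r * w) / (c - r * b)) ^ d / (c - r * w) ^ 2) w := by
  have hx : ∀ v, v < ws → 0 < c - r * v := by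
    intro v hv
    rw [hws, lt_div_iff₀ hr] at hv; linarith
  have hxw := hx w hw
  have hxb := hx b hb
  have hlin : HasDerivAt (fun w => c - r * w) (-r) w := by
    simpa using ((hasDerivAt_id w).const_mul r).const_sub c
  have h1 : HasDerivAt (fun w => ((c - r * w) / (c - r * b)) ^ d)
      (-(r * d) * ((c - r * w) / (c - r * b)) ^ d / (c - r * w)) w := by
    have := (hlin.div_const (c - r * b)).rpow_const (p := d) (Or.inl (by positivity))
    convert this using 1
    rw [Real.rpow_sub_one (by positivity)]
    field_simp
  refine ⟨hxw, h1, ?_⟩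
  refine ((h1.const_mul (-(r * d))).div hlin hxw.ne').congr_deriv ?_
  field_simp

theorem aux_phi (y y1 : ℝ → ℝ) (a y2 w : ℝ) (h1 : HasDerivAt y (y1 w) w)
    (h2 : HasDerivAt y1 y2 w) :
    HasDerivAt (fun w => y w + a * (y w - y w ^ 2)) (y1 w * (1 + a * (1 - 2 * y w))) w ∧
    HasDerivAt (fun w => y1 w * (1 + a * (1 - 2 * y w)))
      (y2 * (1 + a * (1 - 2 * y w)) + y1 w * (-2 * a * y1 w)) w := by
  constructor
  · refine (h1.add ((h1.sub (h1.pow 2)).const_mul a)).congr_deriv ?_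
    simp only [Nat.cast_ofNat, Nat.add_one_sub_one, pow_one]
    ring
  · refine (h2.mul ((((h1.const_mul 2).const_sub 1).const_mul a).const_add 1)).congr_deriv ?_
    ring

/-- Pointwise: compare the operator at two values of the second derivative. -/
theorem aux_super (r R lam d e eps x y P S G ψ p qψ qφ : ℝ) (hr : 0 < r) (hR : 0 < R)
    (hlam : 0 < lam) (hd : 0 < d) (hx : 0 < x) (hy : 0 < y)
    (hp : p = -(r * d) * y / x * P)
    (hq : eps * p ^ 2 + qφ = r ^ 2 / x ^ 2 * d * y * (e * P + d * y * S))
    (hpos : 0 < eps * p ^ 2 + qψ) (hle : qψ ≤ qφ)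
    (hode : lam * ψ = - R * p ^ 2 / (eps * p ^ 2 + qψ) + (-x) * p)
    (hres : 0 ≤ (lam * G - r * d * y * P) * (e * P + d * y * S) + R * d * y * P ^ 2) :
    ψ ≤ G := by
  have hDφ : 0 < eps * p ^ 2 + qφ := by linarith
  have hD : 0 < e * P + d * y * S := by
    rw [hq] at hDφ
    exact pos_of_mul_pos_right hDφ (by positivity)
  have h1 : R * p ^ 2 / (eps * p ^ 2 + qφ) ≤ R * p ^ 2 / (eps * p ^ 2 + qψ) :=
    div_le_div_of_nonneg_left (by positivity) hpos (by linarith)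
  have h2 : R * p ^ 2 / (eps * p ^ 2 + qφ) = R * d * y * P ^ 2 / (e * P + d * y * S) := by
    rw [hq, hp]; field_simp
  have h3 : (-x) * p = r * d * y * P := by rw [hp]; field_simp
  have h4 : r * d * y * P - lam * G ≤ R * d * y * P ^ 2 / (e * P + d * y * S) := by
    rw [le_div_iff₀ hD]; linarith
  have h5 : - R * p ^ 2 / (eps * p ^ 2 + qψ) = - (R * p ^ 2 / (eps * p ^ 2 + qψ)) := by ring
  rw [h5, h3] at hode
  nlinarith

theorem aux_sub (r R lam d e eps x y P S G ψ p qψ qφ : ℝ) (hr : 0 < r) (hR : 0 < R)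
    (hlam : 0 < lam) (hd : 0 < d) (hx : 0 < x) (hy : 0 < y)
    (hp : p = -(r * d) * y / x * P)
    (hq : eps * p ^ 2 + qφ = r ^ 2 / x ^ 2 * d * y * (e * P + d * y * S))
    (hD : 0 < e * P + d * y * S) (hle : qφ ≤ qψ)
    (hode : lam * ψ = - R * p ^ 2 / (eps * p ^ 2 + qψ) + (-x) * p)
    (hres : (lam * G - r * d * y * P) * (e * P + d * y * S) + R * d * y * P ^ 2 ≤ 0) :
    G ≤ ψ := by
  have hDφ : 0 < eps * p ^ 2 + qφ := by rw [hq]; positivity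
  have h1 : R * p ^ 2 / (eps * p ^ 2 + qψ) ≤ R * p ^ 2 / (eps * p ^ 2 + qφ) :=
    div_le_div_of_nonneg_left (by positivity) hDφ (by linarith)
  have h2 : R * p ^ 2 / (eps * p ^ 2 + qφ) = R * d * y * P ^ 2 / (e * P + d * y * S) := by
    rw [hq, hp]; field_simp
  have h3 : (-x) * p = r * d * y * P := by rw [hp]; field_simp
  have h4 : R * d * y * P ^ 2 / (e * P + d * y * S) ≤ r * d * y * P - lam * G := by
    rw [div_le_iff₀ hD]; linarith
  have h5 : - R * p ^ 2 / (eps * p ^ 2 + qψ) = - (R * p ^ 2 / (eps * p ^ 2 + qψ)) := by ring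
  rw [h5, h3] at hode
  nlinarith

theorem aux_psi (b ws : ℝ) (ψ : ℝ → ℝ) (h2 : ContDiffOn ℝ 2 ψ (Set.Ico b ws)) (w : ℝ)
    (hw : w ∈ Set.Ioo b ws) :
    HasDerivAt ψ (derivWithin ψ (Set.Icc b ws) w) w ∧
    HasDerivAt (derivWithin ψ (Set.Icc b ws))
      (derivWithin (derivWithin ψ (Set.Icc b ws)) (Set.Icc b ws) w) w := by
  have hev : derivWithin ψ (Set.Icc b ws) =ᶠ[nhds w] deriv ψ := by
    filter_upwards [isOpen_Ioo.mem_nhds hw] with v hv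
    exact derivWithin_of_mem_nhds (Icc_mem_nhds hv.1 hv.2)
  have hcd : ContDiffAt ℝ 2 ψ w := h2.contDiffAt (Ico_mem_nhds hw.1 hw.2)
  constructor
  · rw [hev.eq_of_nhds]
    exact (hcd.differentiableAt (by norm_num)).hasDerivAt
  · rw [derivWithin_of_mem_nhds (Icc_mem_nhds hw.1 hw.2)]
    have hd : DifferentiableAt ℝ (deriv ψ) w := by
      have : ContDiffAt ℝ 1 (deriv ψ) w := hcd.derivWithin (by norm_num)
      exact this.differentiableAt (by norm_num)
    exact (hd.congr_of_eventuallyEq hev).hasDerivAt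

set_option maxHeartbeats 2000000 in
/-- Uniform small-ε asymptotic expansion of the robust value function:
ψ = ψ₀ + ε·f₁ + O(ε²) uniformly on [b, w_s]. -/
theorem stmt_19 (r μ σ c b ws R lam d K : ℝ)
    (hr : 0 < r) (hμ : r < μ) (hσ : 0 < σ) (hc : 0 < c)
    (hws : ws = c / r) (hb : b < ws)
    (hR : R = (1 / 2) * ((μ - r) / σ) ^ 2)
    (hlam : 0 < lam)
    (hd : d = (1 / (2 * r)) *
      ((r + lam + R) + Real.sqrt ((r + lam + R) ^ 2 - 4 * r * lam)))
    (hK : K = R * d ^ 2 / ((d - 1) ^ 2 * (2 * d * r - lam) + 2 * R * d))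
    (ψ₀ : ℝ → ℝ)
    (hψ₀ : ∀ w, ψ₀ w = ((c - r * w) / (c - r * b)) ^ d)
    (f₁ : ℝ → ℝ)
    (hf₁ : ∀ w, f₁ w = K * (ψ₀ w - (ψ₀ w) ^ 2)) :
    ∃ C > (0 : ℝ), ∃ ε₀ > (0 : ℝ), ∀ eps : ℝ, 0 < eps → eps < ε₀ →
      ∀ ψ : ℝ → ℝ,
        ContDiffOn ℝ 1 ψ (Set.Icc b ws) →
        ContDiffOn ℝ 2 ψ (Set.Ico b ws) →
        ψ b = 1 → ψ ws = 0 →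
        (∀ w ∈ Set.Icc b ws, ψ w ∈ Set.Icc (0 : ℝ) 1) →
        (∀ w ∈ Set.Ico b ws,
          derivWithin ψ (Set.Icc b ws) w < 0 ∧
          0 < eps * (derivWithin ψ (Set.Icc b ws) w) ^ 2 +
              derivWithin (derivWithin ψ (Set.Icc b ws)) (Set.Icc b ws) w) →
        (∀ w ∈ Set.Ioo b ws,
          lam * ψ w =
            - R * (derivWithin ψ (Set.Icc b ws) w) ^ 2 /
                (eps * (derivWithin ψ (Set.Icc b ws) w) ^ 2 +
                  derivWithin (derivWithin ψ (Set.Icc b ws)) (Set.Icc b ws) w)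
              + (r * w - c) * derivWithin ψ (Set.Icc b ws) w) →
        ∀ w ∈ Set.Icc b ws, |ψ w - ψ₀ w - eps * f₁ w| ≤ C * eps ^ 2 := by
  have hRpos : 0 < R := by
    rw [hR]
    have : 0 < (μ - r) / σ := div_pos (by linarith) hσ
    positivity
  obtain ⟨hd1, hroot⟩ := aux_d r R lam d hr hRpos hlam hd
  obtain ⟨e, he⟩ : ∃ e, e = d - 1 := ⟨_, rfl⟩
  have hepos : 0 < e := by linarith
  have hdpos : 0 < d := by linarith
  obtain ⟨κ, hκ⟩ : ∃ κ, κ = R * d ^ 2 / e ^ 2 := ⟨_, rfl⟩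
  have hκpos : 0 < κ := by rw [hκ]; positivity
  obtain ⟨Λ, hΛ⟩ : ∃ Λ, Λ = lam + 2 * κ := ⟨_, rfl⟩
  have hΛpos : 0 < Λ := by rw [hΛ]; positivity
  have hden : (d - 1) ^ 2 * (2 * d * r - lam) + 2 * R * d = lam * e ^ 2 + 2 * R * d ^ 2 := by
    rw [he]; linear_combination (2 * (d - 1)) * hroot
  have hKΛ : K * Λ = κ := by
    rw [hK, hden, hΛ, hκ]
    have : 0 < lam * e ^ 2 + 2 * R * d ^ 2 := by positivity
    field_simp
  have hKpos : 0 < K := by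
    rw [hK, hden]; positivity
  clear hK hd hR
  obtain ⟨B, hB⟩ : ∃ B, B = 9 * e * κ * K + 2 * lam * K * d * (4 * K + 3) := ⟨_, rfl⟩
  have hBpos : 0 < B := by rw [hB]; positivity
  obtain ⟨M, hM⟩ : ∃ M, M = 2 * B / (e * Λ) := ⟨_, rfl⟩
  have hMpos : 0 < M := by rw [hM]; positivity
  have hMB : e * (1 / 2) * (M * Λ) = B := by rw [hM]; field_simp
  obtain ⟨y, hy⟩ : ∃ y : ℝ → ℝ, y = fun w => ((c - r * w) / (c - r * b)) ^ d := ⟨_, rfl⟩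
  have hψy : ∀ w, ψ₀ w = y w := fun w => by rw [hψ₀, hy]
  obtain ⟨y1, hy1⟩ : ∃ y1 : ℝ → ℝ, y1 = fun w => -(r * d) * y w / (c - r * w) := ⟨_, rfl⟩
  obtain ⟨y2, hy2⟩ : ∃ y2 : ℝ → ℝ, y2 = fun w => r ^ 2 * d * (d - 1) * y w / (c - r * w) ^ 2 :=
    ⟨_, rfl⟩
  have hyD : ∀ w, w < ws → 0 < c - r * w ∧ HasDerivAt y (y1 w) w ∧ HasDerivAt y1 (y2 w) w := by
    intro w hw
    have := aux_psi0 r c b ws d w hr hws hb hw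
    subst hy hy1 hy2
    exact this
  have hxb : 0 < c - r * b := (hyD b hb).1
  have hyc : Continuous y := by
    rw [hy]
    exact Continuous.rpow_const (by fun_prop) (fun _ => Or.inr hdpos.le)
  have hyb : y b = 1 := by rw [hy]; simp [div_self hxb.ne']
  have hyws : y ws = 0 := by
    have : c - r * ws = 0 := by rw [hws]; field_simp; ring
    rw [hy]; simp [this, Real.zero_rpow hdpos.ne']
  have hypos : ∀ w, w < ws → 0 < y w := by
    intro w hw
    have := (hyD w hw).1
    rw [hy]; exact Real.rpow_pos_of_pos (by positivity) _
  have hyle : ∀ w, b ≤ w → w < ws → y w ≤ 1 := by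
    intro w hbw hw
    have := (hyD w hw).1
    rw [hy]
    refine Real.rpow_le_one (by positivity) ?_ hdpos.le
    rw [div_le_one hxb]; nlinarith
  have hyI : ∀ w ∈ Set.Icc b ws, 0 ≤ y w ∧ y w ≤ 1 := by
    intro w hw
    rcases hw.2.lt_or_eq with h | h
    · exact ⟨(hypos w h).le, hyle w hw.1 h⟩
    · rw [h, hyws]; norm_num
  refine ⟨M, hMpos, min (K / M) (min (1 / (4 * K)) (e / (2 * d * (4 * K + 3)))), by positivity, ?_⟩
  intro eps heps hlt ψ _hC1 hC2 hψb hψws _ hsgn hode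
  obtain ⟨hl1, hl23⟩ := lt_min_iff.1 hlt
  obtain ⟨hl2, hl3⟩ := lt_min_iff.1 hl23
  rw [lt_div_iff₀ hMpos] at hl1
  rw [lt_div_iff₀ (by positivity)] at hl2
  rw [lt_div_iff₀ (by positivity)] at hl3
  have ha2 : 4 * K * eps ≤ 1 := by linarith
  have hψc : ContinuousOn ψ (Set.Icc b ws) := _hC1.continuousOn
  have hMe : M * eps ^ 2 ≤ K * eps := by nlinarith
  have hφq : ∀ a w, w < ws →
      eps * (y1 w * (1 + a * (1 - 2 * y w))) ^ 2 +
        (y2 w * (1 + a * (1 - 2 * y w)) + y1 w * (-2 * a * y1 w)) =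
      r ^ 2 / (c - r * w) ^ 2 * d * y w * (e * (1 + a * (1 - 2 * y w)) +
        d * y w * (-2 * a + eps * (1 + a * (1 - 2 * y w)) ^ 2)) := by
    intro a w hw
    have := (hyD w hw).1
    rw [hy1, hy2, he]
    field_simp
    ring
  have hodeX : ∀ w ∈ Set.Ioo b ws, lam * ψ w =
            - R * (derivWithin ψ (Set.Icc b ws) w) ^ 2 /
                (eps * (derivWithin ψ (Set.Icc b ws) w) ^ 2 +
                  derivWithin (derivWithin ψ (Set.Icc b ws)) (Set.Icc b ws) w)
              + (-(c - r * w)) * derivWithin ψ (Set.Icc b ws) w := by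
    intro w hw
    rw [hode w hw]; ring
  have hφc : ∀ a : ℝ, Continuous (fun w => y w + a * (y w - y w ^ 2)) := by
    intro a; fun_prop
  -- upper barrier
  have hup : ∀ w ∈ Set.Icc b ws,
      ψ w - (y w + (K * eps + M * eps ^ 2) * (y w - y w ^ 2)) ≤ 0 := by
    obtain ⟨a, ha⟩ : ∃ a, a = K * eps + M * eps ^ 2 := ⟨_, rfl⟩
    rw [← ha]
    have ha0 : 0 ≤ a := by rw [ha]; positivity
    have ha1 : a ≤ 2 * K * eps := by linarith
    refine aux_maxp b ws hb (fun w => ψ w - (y w + a * (y w - y w ^ 2)))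
      (fun w => derivWithin ψ (Set.Icc b ws) w - y1 w * (1 + a * (1 - 2 * y w)))
      (fun w => derivWithin (derivWithin ψ (Set.Icc b ws)) (Set.Icc b ws) w -
        (y2 w * (1 + a * (1 - 2 * y w)) + y1 w * (-2 * a * y1 w)))
      (hψc.sub (hφc a).continuousOn) ?_ ?_ ?_ ?_ ?_
    · simp [hψb, hyb]
    · simp [hψws, hyws]
    · intro w hw
      exact (aux_psi b ws ψ hC2 w hw).1.sub
        (aux_phi y y1 a (y2 w) w (hyD w hw.2).2.1 (hyD w hw.2).2.2).1
    · intro w hw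
      exact (aux_psi b ws ψ hC2 w hw).2.sub
        (aux_phi y y1 a (y2 w) w (hyD w hw.2).2.1 (hyD w hw.2).2.2).2
    · intro w hw h0 h1 h2
      have h0' : 0 < ψ w - (y w + a * (y w - y w ^ 2)) := h0
      have h1' : derivWithin ψ (Set.Icc b ws) w = y1 w * (1 + a * (1 - 2 * y w)) :=
        sub_eq_zero.1 h1
      have h2' := sub_nonpos.1 h2
      have hyp := hypos w hw.2
      have hyl := hyle w hw.1.le hw.2
      obtain ⟨hP, hS, hres⟩ := aux_bounds e d κ K lam a eps (y w) _ _ B hepos hdpos hκpos hKpos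
        hlam heps ha0 ha1 ha2 hyp.le hyl rfl rfl hB
      have hid := aux_resid r R lam d e κ Λ a eps (y w) _ _ hepos.ne' he hroot hκ hΛ rfl rfl
      have hkey := aux_super r R lam d e eps (c - r * w) (y w) (1 + a * (1 - 2 * y w))
        (-2 * a + eps * (1 + a * (1 - 2 * y w)) ^ 2) (y w + a * (y w - y w ^ 2)) (ψ w) _ _ _
        hr hRpos hlam hdpos (hyD w hw.2).1 hyp
        (by rw [h1', hy1]) (by rw [h1']; exact hφq a w hw.2) (hsgn w ⟨hw.1.le, hw.2⟩).2 h2'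
        (hodeX w hw) (by
          rw [hid]
          apply mul_nonneg (sq_nonneg _)
          have h3 := (abs_le.1 hres).1
          generalize -2 * a + eps * (1 + a * (1 - 2 * y w)) ^ 2 = S at *
          generalize 1 + a * (1 - 2 * y w) = P at *
          have h4 : Λ * a - κ * eps * P ^ 2 = M * Λ * eps ^ 2 + κ * eps * (1 - P ^ 2) := by
            rw [ha, ← hKΛ]; ring
          have h5 : e * (1 / 2) * (M * Λ) * eps ^ 2 ≤ e * P * (M * Λ) * eps ^ 2 := by gcongr
          rw [hMB] at h5
          rw [h4]
          linarith)
      linarith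
  -- lower barrier
  have hlo : ∀ w ∈ Set.Icc b ws,
      (y w + (K * eps - M * eps ^ 2) * (y w - y w ^ 2)) - ψ w ≤ 0 := by
    obtain ⟨a, ha⟩ : ∃ a, a = K * eps - M * eps ^ 2 := ⟨_, rfl⟩
    rw [← ha]
    have ha0 : 0 ≤ a := by linarith
    have ha1 : a ≤ 2 * K * eps := by
      have : 0 < M * eps ^ 2 := by positivity
      have : 0 < K * eps := by positivity
      linarith
    refine aux_maxp b ws hb (fun w => (y w + a * (y w - y w ^ 2)) - ψ w)
      (fun w => y1 w * (1 + a * (1 - 2 * y w)) - derivWithin ψ (Set.Icc b ws) w)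
      (fun w => (y2 w * (1 + a * (1 - 2 * y w)) + y1 w * (-2 * a * y1 w)) -
        derivWithin (derivWithin ψ (Set.Icc b ws)) (Set.Icc b ws) w)
      ((hφc a).continuousOn.sub hψc) ?_ ?_ ?_ ?_ ?_
    · simp [hψb, hyb]
    · simp [hψws, hyws]
    · intro w hw
      exact (aux_phi y y1 a (y2 w) w (hyD w hw.2).2.1 (hyD w hw.2).2.2).1.sub
        (aux_psi b ws ψ hC2 w hw).1
    · intro w hw
      exact (aux_phi y y1 a (y2 w) w (hyD w hw.2).2.1 (hyD w hw.2).2.2).2.sub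
        (aux_psi b ws ψ hC2 w hw).2
    · intro w hw h0 h1 h2
      have h0' : 0 < (y w + a * (y w - y w ^ 2)) - ψ w := h0
      have h1' : derivWithin ψ (Set.Icc b ws) w = y1 w * (1 + a * (1 - 2 * y w)) :=
        (sub_eq_zero.1 h1).symm
      have h2' := sub_nonpos.1 h2
      have hyp := hypos w hw.2
      have hyl := hyle w hw.1.le hw.2
      obtain ⟨hP, hS, hres⟩ := aux_bounds e d κ K lam a eps (y w) _ _ B hepos hdpos hκpos hKpos
        hlam heps ha0 ha1 ha2 hyp.le hyl rfl rfl hB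
      have hid := aux_resid r R lam d e κ Λ a eps (y w) _ _ hepos.ne' he hroot hκ hΛ rfl rfl
      have hkey := aux_sub r R lam d e eps (c - r * w) (y w) (1 + a * (1 - 2 * y w))
        (-2 * a + eps * (1 + a * (1 - 2 * y w)) ^ 2) (y w + a * (y w - y w ^ 2)) (ψ w) _ _ _
        hr hRpos hlam hdpos (hyD w hw.2).1 hyp
        (by rw [h1', hy1]) (by rw [h1']; exact hφq a w hw.2) (by
          have h3 := (abs_le.1 hS).1
          generalize -2 * a + eps * (1 + a * (1 - 2 * y w)) ^ 2 = S at *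
          generalize 1 + a * (1 - 2 * y w) = P at *
          have h4 : |y w * S| ≤ 1 * ((4 * K + 3) * eps) := by
            rw [abs_mul, abs_of_pos hyp]
            exact mul_le_mul hyl hS (abs_nonneg _) (by norm_num)
          have h5 := (abs_le.1 h4).1
          have h6 := mul_le_mul_of_nonneg_left h5 hdpos.le
          have h7 := mul_le_mul_of_nonneg_left hP hepos.le
          linarith) h2'
        (hodeX w hw) (by
          rw [hid]
          apply mul_nonpos_of_nonneg_of_nonpos (sq_nonneg _)
          have h3 := (abs_le.1 hres).2
          generalize -2 * a + eps * (1 + a * (1 - 2 * y w)) ^ 2 = S at *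
          generalize 1 + a * (1 - 2 * y w) = P at *
          have h4 : Λ * a - κ * eps * P ^ 2 = -(M * Λ * eps ^ 2) + κ * eps * (1 - P ^ 2) := by
            rw [ha, ← hKΛ]; ring
          have h5 : e * (1 / 2) * (M * Λ) * eps ^ 2 ≤ e * P * (M * Λ) * eps ^ 2 := by gcongr
          rw [hMB] at h5
          rw [h4]
          linarith)
      linarith
  intro w hw
  have hu := hup w hw
  have hl := hlo w hw
  obtain ⟨hy0, hyle1⟩ := hyI w hw
  have hz : y w - y w ^ 2 ≤ 1 := by nlinarith
  have hz2 : M * eps ^ 2 * (y w - y w ^ 2) ≤ M * eps ^ 2 * 1 :=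
    mul_le_mul_of_nonneg_left hz (by positivity)
  rw [hf₁, hψy, abs_le]
  constructor <;> linarith
end
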